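/- arXiv:1406.0867 — 2 statements merged into one kernel-verified Lean document; each statement's English description precedes it below -/
import Mathlib

section
/- Let k be a field of characteristic zero and let d ≥ 4 be a natural number. Then there exists an affine Poisson k-algebra (a finitely generated integral domain k-algebra with a Poisson bracket) of Krull dimension d such that the zero ideal (0) is Poisson rational but not Poisson locally closed. -/
/-- A Poisson bracket on a commutative `k`-algebra `A`: a `k`-bilinear map which is
antisymmetric, satisfies the Jacobi identity, and the Leibniz rule. -/
structure PoissonBracket (k A : Type*) [CommRing k] [CommRing A] [Algebra k A] where
  br : A →ₗ[k] A →ₗ[k] A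
  antisymm : ∀ a b : A, br a b = - br b a
  jacobi : ∀ a b c : A, br a (br b c) + br c (br a b) + br b (br c a) = 0
  leibniz : ∀ a b c : A, br (a * b) c = a * br b c + b * br a c

/-- An ideal `I` is a Poisson ideal if `{I, A} ⊆ I`. -/
def PoissonBracket.IsPoissonIdeal {k A : Type*} [CommRing k] [CommRing A] [Algebra k A]
    (pb : PoissonBracket k A) (I : Ideal A) : Prop :=
  ∀ a ∈ I, ∀ b : A, pb.br a b ∈ I

/-- `P` is Poisson locally closed if the intersection of all Poisson prime ideals strictly
containing `P` is strictly larger than `P`. -/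
def PoissonBracket.IsPoissonLocallyClosed {k A : Type*} [CommRing k] [CommRing A] [Algebra k A]
    (pb : PoissonBracket k A) (P : Ideal A) : Prop :=
  P < sInf {Q : Ideal A | Q.IsPrime ∧ pb.IsPoissonIdeal Q ∧ P < Q}

/-- `P` is Poisson rational: every element of the Poisson center of the fraction field of
`A ⧸ P` (with the unique extension of the Poisson bracket, captured by quantifying over
all compatible Poisson brackets on `Frac(A ⧸ P)`) is algebraic over `k`. -/
def PoissonBracket.IsPoissonRational {k A : Type*} [Field k] [CommRing A] [Algebra k A]
    (pb : PoissonBracket k A) (P : Ideal A) : Prop :=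
  ∀ pbF : PoissonBracket k (FractionRing (A ⧸ P)),
    (∀ a b : A,
      pbF.br (algebraMap (A ⧸ P) (FractionRing (A ⧸ P)) (Ideal.Quotient.mk P a))
          (algebraMap (A ⧸ P) (FractionRing (A ⧸ P)) (Ideal.Quotient.mk P b)) =
        algebraMap (A ⧸ P) (FractionRing (A ⧸ P)) (Ideal.Quotient.mk P (pb.br a b))) →
    ∀ f : FractionRing (A ⧸ P), (∀ g, pbF.br f g = 0) → IsAlgebraic k f

/-- An affine Poisson `k`-algebra of Krull dimension `d` in which the zero ideal is
Poisson rational but not Poisson locally closed. -/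
structure PoissonCounterexampleOver (k : Type u) [Field k] (d : ℕ) : Type (u + 1) where
  A : Type u
  [commRing : CommRing A]
  [isDomain : IsDomain A]
  [alg : Algebra k A]
  finiteType : Algebra.FiniteType k A
  pb : PoissonBracket k A
  krullDim : ringKrullDim A = d
  rational : pb.IsPoissonRational ⊥
  not_locallyClosed : ¬ pb.IsPoissonLocallyClosed ⊥

noncomputable section PoisCexHelpers
open Polynomial
namespace PoisCex

section generic
variable {k R : Type*} [Field k] [CommRing R] [Algebra k R]

/-- Coefficientwise extension of a derivation to the polynomial ring. -/
def mc (d : Derivation k R R) : Derivation k R[X] R[X] :=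
  (PolynomialModule.equivPolynomialSelf (R := R)).compDer d.mapCoeffs

@[simp] lemma mc_coeff (d : Derivation k R R) (p : R[X]) (i : ℕ) :
    (mc d p).coeff i = d (p.coeff i) := rfl

@[simp] lemma mc_C (d : Derivation k R R) (a : R) : mc d (C a) = C (d a) := by
  ext i
  rw [mc_coeff, coeff_C, coeff_C]
  split_ifs <;> simp

@[simp] lemma mc_X (d : Derivation k R R) : mc d (X : R[X]) = 0 := by
  ext i
  rw [mc_coeff, coeff_X]
  split_ifs <;> simp

lemma mc_natDegree (d : Derivation k R R) (p : R[X]) : (mc d p).natDegree ≤ p.natDegree := by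
  rw [natDegree_le_iff_coeff_eq_zero]
  intro n hn
  rw [mc_coeff, coeff_eq_zero_of_natDegree_lt hn, map_zero]

/-- The usual derivative, as a `k`-derivation. -/
def dX : Derivation k R[X] R[X] := (derivative' (R := R)).restrictScalars k

@[simp] lemma dX_apply (p : R[X]) : dX (k := k) p = derivative p := rfl

lemma mc_derivative (d : Derivation k R R) (p : R[X]) :
    derivative (mc d p) = mc d (derivative p) := by
  ext i
  rw [mc_coeff, coeff_derivative, coeff_derivative, mc_coeff]
  have : ((i : R) + 1) = ((i + 1 : ℕ) : R) := by push_cast; ring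
  rw [this, Derivation.leibniz, Derivation.map_natCast]
  simp [mul_comm]

lemma X_derivative_natDegree (p : R[X]) : (X * derivative p).natDegree ≤ p.natDegree := by
  rw [natDegree_le_iff_coeff_eq_zero]
  intro n hn
  rcases n with _ | n
  · simp
  · rw [coeff_X_mul, coeff_derivative, coeff_eq_zero_of_natDegree_lt hn, zero_mul]

lemma X_derivative_coeff (p : R[X]) (n : ℕ) :
    (X * derivative p).coeff n = n * p.coeff n := by
  rcases n with _ | n
  · simp
  · rw [coeff_X_mul, coeff_derivative]; push_cast; ring

/-- The main induction on leading coefficients. -/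
lemma ratio_of_lead [IsDomain R] (P : R[X] → R[X] → Prop)
    (hP : ∀ N M, ∀ c : k, P N M → P (N - c • M) M)
    (H : ∀ N M, N ≠ 0 → M ≠ 0 → P N M → N.natDegree = M.natDegree ∧
      ∃ c : k, N.leadingCoeff = c • M.leadingCoeff) :
    ∀ N M, M ≠ 0 → P N M → ∃ c : k, N = c • M := by
  intro N M hM h
  by_cases hN : N = 0
  · exact ⟨0, by simp [hN]⟩
  obtain ⟨hd, c, hc⟩ := H N M hN hM h
  refine ⟨c, ?_⟩
  by_contra hne
  have hW : N - c • M ≠ 0 := sub_ne_zero.mpr hne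
  obtain ⟨hd2, -⟩ := H _ M hW hM (hP _ _ c h)
  have : (N - c • M).coeff (N - c • M).natDegree = 0 := by
    rw [hd2, coeff_sub, coeff_smul, ← hd]
    have h1 := hc
    unfold leadingCoeff at h1
    rw [h1, hd, sub_self]
  exact hW (leadingCoeff_eq_zero.mp this)

lemma deriv_natDegree_eq [IsDomain R] [CharZero R] {U V : R[X]} (hU : U ≠ 0) (hV : V ≠ 0)
    (h : derivative U * V = U * derivative V) : U.natDegree = V.natDegree := by
  have h2 : (X * derivative U) * V = U * (X * derivative V) := by
    linear_combination X * h
  have h3 := congrArg (fun p => p.coeff (U.natDegree + V.natDegree)) h2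
  beta_reduce at h3
  rw [coeff_mul_add_eq_of_natDegree_le (X_derivative_natDegree U) le_rfl,
    coeff_mul_add_eq_of_natDegree_le le_rfl (X_derivative_natDegree V),
    X_derivative_coeff, X_derivative_coeff] at h3
  have hu : U.coeff U.natDegree ≠ 0 := by simpa using hU
  have hv : V.coeff V.natDegree ≠ 0 := by simpa using hV
  have h4 : ((U.natDegree : R) - V.natDegree) * (U.coeff U.natDegree * V.coeff V.natDegree) = 0 := by
    linear_combination h3
  rcases mul_eq_zero.mp h4 with h5 | h5
  · exact_mod_cast sub_eq_zero.mp h5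
  · exact absurd h5 (mul_ne_zero hu hv)

lemma deriv_const [IsDomain R] [CharZero R] {U V : R[X]} (hV : V ≠ 0)
    (h : derivative U * V = U * derivative V) :
    C V.leadingCoeff * U = C U.leadingCoeff * V := by
  by_contra hne
  have hW := sub_ne_zero.mpr hne
  have hU : U ≠ 0 := by rintro rfl; simp at hne
  have e := deriv_natDegree_eq hU hV h
  have e2 := deriv_natDegree_eq hW hV (by
    simp only [derivative_sub, derivative_mul, derivative_C, zero_mul, zero_add]
    linear_combination C V.leadingCoeff * h)
  apply hW
  rw [← leadingCoeff_eq_zero]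
  rw [leadingCoeff, e2]
  simp only [coeff_sub, coeff_C_mul]
  rw [leadingCoeff, leadingCoeff, ← e]; ring

/-- Differential rings with all properties we want. -/
structure Good (δ : Derivation k R R) : Prop where
  cst : ∀ N M : R, M ≠ 0 → δ N * M = N * δ M → ∃ c : k, N = c • M
  ex : ∃ r : R, ∀ a b : R, a ≠ 0 → b ≠ 0 → ∀ n : ℤ,
    δ a * b - a * δ b = (n : R) * (r * (a * b)) → n = 0
  dense : ∀ F : R, F ≠ 0 → ∃ P : Ideal R, P.IsPrime ∧ (∀ x ∈ P, δ x ∈ P) ∧ P ≠ ⊥ ∧ F ∉ P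

lemma coeff_X_mul_top (p : R[X]) (n : ℕ) : (X * p).coeff (n + 1) = p.coeff n := coeff_X_mul p n

lemma dense_poly {δ : Derivation k R R} (h : Good δ) (F : R[X]) (hF : F ≠ 0) :
    ∃ P : Ideal R, P.IsPrime ∧ (∀ x ∈ P, δ x ∈ P) ∧ (Ideal.map (C : R →+* R[X]) P) ≠ ⊥ ∧
      F ∉ Ideal.map (C : R →+* R[X]) P := by
  obtain ⟨P, h1, h2, h3, h4⟩ := h.dense F.leadingCoeff (by simpa using hF)
  refine ⟨P, h1, h2, ?_, ?_⟩
  · intro h5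
    apply h3
    rw [Ideal.map_eq_bot_iff_of_injective C_injective] at h5
    exact h5
  · rw [Ideal.mem_map_C_iff]
    intro h5
    exact h4 (h5 _)

lemma good_step [IsDomain R] [CharZero R] {δ : Derivation k R R} (h : Good δ) :
    ∃ δ' : Derivation k R[X] R[X], Good δ' := by
  obtain ⟨r, hr⟩ := h.ex
  let δ' : Derivation k R[X] R[X] := mc δ + (C r * X) • dX
  have happ : ∀ N, δ' N = mc δ N + C r * (X * derivative N) := by
    intro N
    simp [δ', mul_assoc]
  have hdeg : ∀ N, (δ' N).natDegree ≤ N.natDegree := by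
    intro N
    rw [happ]
    refine natDegree_add_le_of_degree_le (mc_natDegree _ _) ?_
    exact (natDegree_C_mul_le _ _).trans (X_derivative_natDegree _)
  have hco : ∀ N n, (δ' N).coeff n = δ (N.coeff n) + r * (n * N.coeff n) := by
    intro N n
    rw [happ, coeff_add, mc_coeff, coeff_C_mul, X_derivative_coeff]
  refine ⟨δ', ?_, ⟨X, ?_⟩, ?_⟩
  · apply ratio_of_lead (fun N M => δ' N * M = N * δ' M)
    · intro N M c hh
      simp only [map_sub, Derivation.map_smul, sub_mul, hh, smul_mul_assoc]
      simp only [mul_comm M]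
    · intro N M hN hM hh
      have h3 := congrArg (fun p => p.coeff (N.natDegree + M.natDegree)) hh
      beta_reduce at h3
      rw [coeff_mul_add_eq_of_natDegree_le (hdeg N) le_rfl,
        coeff_mul_add_eq_of_natDegree_le le_rfl (hdeg M), hco, hco] at h3
      simp only [coeff_natDegree] at h3
      have hN' : N.leadingCoeff ≠ 0 := by simpa using hN
      have hM' : M.leadingCoeff ≠ 0 := by simpa using hM
      have h4 := hr _ _ hN' hM' ((M.natDegree : ℤ) - N.natDegree) (by
        push_cast
        linear_combination h3)
      have h5 : N.natDegree = M.natDegree := by omega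
      refine ⟨h5, h.cst _ _ hM' ?_⟩
      rw [h5] at h3
      linear_combination h3
  · intro a b ha hb n hn
    have h3 := congrArg (fun p => p.coeff (a.natDegree + b.natDegree + 1)) hn
    simp only [coeff_sub] at h3
    have e : ((n : R[X]) * (X * (a * b))) = C (n : R) * (X * (a * b)) := by simp
    rw [e, coeff_C_mul, coeff_X_mul, coeff_mul_add_eq_of_natDegree_le le_rfl le_rfl,
      coeff_eq_zero_of_natDegree_lt, coeff_eq_zero_of_natDegree_lt] at h3
    · simp only [coeff_natDegree, sub_zero] at h3
      have := h3.symm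
      simpa [ha, hb] using this
    · refine lt_of_le_of_lt natDegree_mul_le ?_
      have := hdeg b
      omega
    · refine lt_of_le_of_lt natDegree_mul_le ?_
      have := hdeg a
      omega
  · intro F hF
    obtain ⟨P, h1, h2, h3, h4⟩ := dense_poly h F hF
    refine ⟨_, Ideal.isPrime_map_C_of_isPrime, ?_, h3, h4⟩
    intro x hx
    rw [Ideal.mem_map_C_iff] at hx ⊢
    intro n
    rw [hco]
    exact P.add_mem (h2 _ (hx n)) (P.mul_mem_left _ (P.mul_mem_left _ (hx n)))

end generic

/-- the Poisson bracket on `R[X]` -/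
def pbr {k R : Type*} [Field k] [CommRing R] [Algebra k R] (δ : Derivation k R R) :
    PoissonBracket k R[X] where
  br := LinearMap.mk₂ k (fun a b => mc δ a * derivative b - derivative a * mc δ b)
    (by intros; simp only [map_add]; ring)
    (by intros; simp only [Derivation.map_smul, derivative_smul, smul_mul_assoc, smul_sub])
    (by intros; simp only [map_add]; ring)
    (by intros; simp only [Derivation.map_smul, derivative_smul, mul_smul_comm, smul_sub])
  antisymm a b := by simp only [LinearMap.mk₂_apply]; ring
  jacobi a b c := by
    simp only [LinearMap.mk₂_apply, map_sub, Derivation.leibniz, derivative_mul, mc_derivative,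
      smul_eq_mul]
    ring
  leibniz a b c := by
    simp only [LinearMap.mk₂_apply, Derivation.leibniz, derivative_mul, smul_eq_mul]
    ring

lemma pbr_apply {k R : Type*} [Field k] [CommRing R] [Algebra k R] (δ : Derivation k R R)
    (a b : R[X]) : (pbr δ).br a b = mc δ a * derivative b - derivative a * mc δ b := rfl

lemma pb_quot {k K : Type*} [Field k] [Field K] [Algebra k K] (pb : PoissonBracket k K)
    (a b g : K) (hb : b ≠ 0) (h : pb.br (a / b) g = 0) : pb.br a g * b = a * pb.br b g := by
  have h1 := pb.leibniz (a / b) b g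
  rw [div_mul_cancel₀ _ hb, h, mul_zero, add_zero] at h1
  rw [h1]
  field_simp

lemma rational_of_good {k R : Type*} [Field k] [CommRing R] [IsDomain R] [CharZero R]
    [Algebra k R] {δ : Derivation k R R} (h : Good δ) (hne : ∃ r, δ r ≠ 0) :
    (pbr δ).IsPoissonRational ⊥ := by
  intro pbF hc f hf
  set B := R[X] ⧸ (⊥ : Ideal R[X])
  have hinj : Function.Injective (algebraMap R[X] B) := by
    rw [injective_iff_map_eq_zero]
    intro a ha
    simpa using Ideal.Quotient.eq_zero_iff_mem.mp ha
  set φ : R[X] → FractionRing B := fun a => algebraMap B (FractionRing B)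
    (Ideal.Quotient.mk (⊥ : Ideal R[X]) a) with hφ
  have φinj : Function.Injective φ := (IsFractionRing.injective B (FractionRing B)).comp hinj
  obtain ⟨N', M', hM', rfl⟩ := IsFractionRing.div_surjective (A := B) f
  obtain ⟨N, rfl⟩ := Ideal.Quotient.mk_surjective N'
  obtain ⟨M, rfl⟩ := Ideal.Quotient.mk_surjective M'
  have hM0 : φ M ≠ 0 := by
    have := nonZeroDivisors.ne_zero hM'
    simpa [hφ] using this
  have hM : M ≠ 0 := by rintro rfl; simp [hφ] at hM0
  have key : ∀ g : R[X], (pbr δ).br N g * M = N * (pbr δ).br M g := by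
    intro g
    have := pb_quot pbF (φ N) (φ M) (φ g) hM0 (hf _)
    simp only [hφ] at this
    rw [hc, hc, ← map_mul, ← map_mul, ← map_mul, ← map_mul] at this
    exact φinj this
  have k1 : mc δ N * M = N * mc δ M := by
    have := key X
    simpa [pbr_apply] using this
  have k2 : derivative N * M = N * derivative M := by
    obtain ⟨r, hr⟩ := hne
    have := key (C r)
    simp only [pbr_apply, derivative_C, mul_zero, zero_sub, mc_C] at this
    have hr' : C (δ r) ≠ 0 := by simpa using hr
    apply mul_left_cancel₀ hr'
    linear_combination -this
  obtain ⟨c, hc⟩ := ratio_of_lead (k := k)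
    (fun N M => mc δ N * M = N * mc δ M ∧ derivative N * M = N * derivative M)
    (by
      rintro N M c ⟨h1, h2⟩
      constructor
      · simp only [map_sub, Derivation.map_smul, sub_mul, h1, smul_mul_assoc]
        simp only [mul_comm M]
      · simp only [derivative_sub, derivative_smul, sub_mul, h2, smul_mul_assoc]
        simp only [mul_comm M])
    (by
      rintro N M hN hM ⟨h1, h2⟩
      have e := deriv_natDegree_eq hN hM h2
      refine ⟨e, h.cst _ _ (by simpa using hM) ?_⟩
      have h3 := congrArg (fun p => p.coeff (N.natDegree + M.natDegree)) h1
      beta_reduce at h3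
      rw [coeff_mul_add_eq_of_natDegree_le (mc_natDegree _ N) le_rfl,
        coeff_mul_add_eq_of_natDegree_le le_rfl (mc_natDegree _ M)] at h3
      exact h3) N M hM ⟨k1, k2⟩
  have : φ N / φ M = algebraMap k (FractionRing B) c := by
    rw [div_eq_iff hM0, hc]
    simp only [hφ]
    rw [Algebra.smul_def, map_mul, map_mul]
    rfl
  change IsAlgebraic k (φ N / φ M)
  rw [this]
  exact isAlgebraic_algebraMap c

lemma not_locallyClosed_of_good {k R : Type*} [Field k] [CommRing R]
    [Algebra k R] {δ : Derivation k R R} (h : Good δ) :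
    ¬ (pbr δ).IsPoissonLocallyClosed ⊥ := by
  intro hh
  unfold PoissonBracket.IsPoissonLocallyClosed at hh
  obtain ⟨F, hF, hF0⟩ := SetLike.exists_of_lt hh
  obtain ⟨P, h1, h2, h3, h4⟩ := dense_poly h F (by simpa using hF0)
  apply h4
  rw [Ideal.mem_sInf] at hF
  apply hF
  refine ⟨Ideal.isPrime_map_C_of_isPrime, ?_, bot_lt_iff_ne_bot.mpr h3⟩
  intro a ha b
  rw [pbr_apply]
  have q1 : mc δ a ∈ Ideal.map (C : R →+* R[X]) P := by
    rw [Ideal.mem_map_C_iff] at ha ⊢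
    exact fun n => h2 _ (ha n)
  have q2 : derivative a ∈ Ideal.map (C : R →+* R[X]) P := by
    rw [Ideal.mem_map_C_iff] at ha ⊢
    intro n
    rw [coeff_derivative]
    exact P.mul_mem_right _ (ha _)
  exact sub_mem (Ideal.mul_mem_right _ _ q1) (Ideal.mul_mem_right _ _ q2)

/-- existence of good differential rings of dimension d -/
def ExGood (k : Type u) [Field k] (d : ℕ) : Prop :=
  ∃ (R : Type u) (_ : CommRing R) (_ : IsDomain R) (_ : Algebra k R) (δ : Derivation k R R),
    Algebra.FiniteType k R ∧ ringKrullDim R = d ∧ Good δ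

lemma exGood_succ (k : Type u) [Field k] [CharZero k] (d : ℕ) (h : ExGood k d) :
    ExGood k (d + 1) := by
  obtain ⟨R, _, _, _, δ, hft, hdim, hg⟩ := h
  have : CharZero R := charZero_of_injective_algebraMap (algebraMap k R).injective
  have : IsNoetherianRing R := Algebra.FiniteType.isNoetherianRing k R
  obtain ⟨δ', h'⟩ := good_step hg
  refine ⟨R[X], inferInstance, inferInstance, inferInstance, δ', ?_, ?_, h'⟩
  · exact Algebra.FiniteType.trans hft inferInstance
  · rw [Polynomial.ringKrullDim_of_isNoetherianRing, hdim]; rfl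

lemma cex_of_exGood (k : Type u) [Field k] [CharZero k] (d : ℕ) (h : ExGood k (d + 1)) :
    Nonempty (PoissonCounterexampleOver k (d + 2)) := by
  obtain ⟨R, _, _, _, δ, hft, hdim, hg⟩ := h
  have : CharZero R := charZero_of_injective_algebraMap (algebraMap k R).injective
  have : IsNoetherianRing R := Algebra.FiniteType.isNoetherianRing k R
  have hne : ∃ r, δ r ≠ 0 := by
    by_contra hcon
    push Not at hcon
    have hfield : IsField R := by
      refine ⟨⟨0, 1, zero_ne_one⟩, mul_comm, ?_⟩
      intro a ha
      obtain ⟨c, hc⟩ := hg.cst 1 a ha (by simp [hcon])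
      exact ⟨algebraMap k R c, by rw [hc, Algebra.smul_def, mul_comm]⟩
    rw [ringKrullDim_eq_zero_of_isField hfield] at hdim
    have : (0 : ℕ) = d + 1 := by exact_mod_cast hdim
    omega
  exact ⟨{ A := R[X]
           finiteType := Algebra.FiniteType.trans hft inferInstance
           pb := pbr δ
           krullDim := by
             rw [Polynomial.ringKrullDim_of_isNoetherianRing, hdim]; rfl
           rational := rational_of_good hg hne
           not_locallyClosed := not_locallyClosed_of_good hg }⟩

section lemR

lemma irr_not_dvd_derivative {K : Type*} [Field K] [CharZero K] {π : K[X]} (h : Irreducible π) :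
    ¬ π ∣ derivative π := by
  intro hd
  have h0 : derivative π ≠ 0 := by
    intro h0
    have := derivative_eq_zero.mp h0
    exact h.natDegree_pos.ne' this
  have h1 := natDegree_le_of_dvd hd h0
  have h2 := natDegree_derivative_lt h.natDegree_pos.ne'
  omega

lemma irr_not_dvd_nat {K : Type*} [Field K] [CharZero K] {π : K[X]} (h : Irreducible π) {n : ℕ}
    (hn : n ≠ 0) : ¬ π ∣ (n : K[X]) := by
  intro hh
  apply h.not_isUnit
  refine isUnit_of_dvd_unit hh ?_
  rw [← C_eq_natCast]
  exact isUnit_C.mpr (IsUnit.mk0 _ (Nat.cast_ne_zero.mpr hn))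

lemma lemR_unit {K : Type*} [Field K] [CharZero K] (f U : K[X]) (hf : f.Monic)
    (hf3 : f.natDegree = 3) (a b : K)
    (h : 2 * f * derivative U + derivative f * U = C a * X + C b) : a = 0 ∧ b = 0 := by
  have hU : U = 0 := by
    by_contra hU
    have h2 : C 2 * (f * (X * derivative U)) + (X * derivative f) * U
        = (C a * X + C b) * X := by
      rw [← h, C_ofNat]; ring
    have h3 := congrArg (fun p => p.coeff (3 + U.natDegree)) h2
    beta_reduce at h3
    rw [coeff_add, coeff_C_mul, coeff_mul_add_eq_of_natDegree_le hf3.le (X_derivative_natDegree U),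
      coeff_mul_add_eq_of_natDegree_le ((X_derivative_natDegree f).trans hf3.le) le_rfl,
      X_derivative_coeff, X_derivative_coeff, ← hf3, coeff_natDegree, hf.leadingCoeff, hf3,
      coeff_natDegree] at h3
    rw [coeff_eq_zero_of_natDegree_lt (p := (C a * X + C b) * X)] at h3
    · have h4 : ((2 * U.natDegree + 3 : ℕ) : K) * U.leadingCoeff = 0 := by
        push_cast; push_cast at h3; linear_combination h3
      rcases mul_eq_zero.mp h4 with h5 | h5
      · have : 2 * U.natDegree + 3 = 0 := by exact_mod_cast h5
        omega
      · exact hU (leadingCoeff_eq_zero.mp h5)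
    · have : ((C a * X + C b) * X).natDegree ≤ 2 := by compute_degree
      omega
  subst hU
  simp only [derivative_zero, mul_zero, add_zero] at h
  constructor
  · have := congrArg (fun p => p.coeff 1) h; simpa using this.symm
  · have := congrArg (fun p => p.coeff 0) h; simpa using this.symm

lemma lemR {K : Type*} [Field K] [CharZero K] (f U V : K[X]) (hf : f.Monic)
    (hf3 : f.natDegree = 3) (hsq : Squarefree f) (hV : V ≠ 0) (a b : K)
    (h : 2 * f * (derivative U * V - U * derivative V) + derivative f * U * V
      = V ^ 2 * (C a * X + C b)) : a = 0 ∧ b = 0 := by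
  obtain ⟨V', U', c, hrel, hc1, hc2⟩ := UniqueFactorizationMonoid.exists_reduced_factors V hV U
  have hc : c ≠ 0 := by rintro rfl; simp at hc1; exact hV hc1.symm
  have hV' : V' ≠ 0 := by rintro rfl; simp at hc1; exact hV hc1.symm
  have h' : 2 * f * (derivative U' * V' - U' * derivative V') + derivative f * U' * V'
      = V' ^ 2 * (C a * X + C b) := by
    rw [← hc1, ← hc2] at h
    simp only [derivative_mul] at h
    apply mul_left_cancel₀ (pow_ne_zero 2 hc)
    linear_combination h
  clear h
  have hunit : IsUnit V' := by
    by_contra hnu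
    obtain ⟨π, hπ, hdvd⟩ := WfDvdMonoid.exists_irreducible_factor hnu hV'
    obtain ⟨W, hVe, hW⟩ := (FiniteMultiplicity.of_prime_left hπ.prime hV').exists_eq_pow_mul_and_not_dvd
    have hp := hπ.prime
    generalize multiplicity π V' = e at hVe
    rcases e with _ | n
    · simp at hVe; rw [hVe] at hdvd; exact hW hdvd
    have hU : ¬ π ∣ U' := fun hu => hπ.not_isUnit (hrel hdvd hu)
    have hd := irr_not_dvd_derivative hπ
    have e1 : derivative V' = π ^ n * (((n : K[X]) + 1) * derivative π * W + π * derivative W) := by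
      rw [hVe, derivative_mul, derivative_pow]
      simp
      ring
    have e2 : 2 * f * (derivative U' * π * W - U' * (((n : K[X]) + 1) * derivative π * W + π * derivative W))
        + derivative f * U' * π * W = π ^ (n + 2) * W ^ 2 * (C a * X + C b) := by
      apply mul_left_cancel₀ (pow_ne_zero n hπ.ne_zero)
      rw [e1, hVe] at h'
      linear_combination h'
    have hn : ¬ π ∣ ((2 * (n + 1) : ℕ) : K[X]) := irr_not_dvd_nat hπ (by omega)
    have hf1 : π ∣ f := by
      have : π ∣ ((2 * (n + 1) : ℕ) : K[X]) * (f * (U' * (derivative π * W))) := by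
        refine ⟨2 * f * (derivative U' * W - U' * derivative W) + derivative f * U' * W
          - π ^ (n + 1) * W ^ 2 * (C a * X + C b), ?_⟩
        push_cast
        linear_combination -e2
      simpa [hp.dvd_mul, hn, hU, hd, hW, -Nat.cast_mul] using this
    obtain ⟨g, rfl⟩ := hf1
    have hn2 : ¬ π ∣ ((2 * n + 1 : ℕ) : K[X]) := irr_not_dvd_nat hπ (by omega)
    have hg : π ∣ g := by
      have : π ∣ ((2 * n + 1 : ℕ) : K[X]) * (g * (U' * (derivative π * W))) := by
        refine ⟨2 * g * (derivative U' * W - U' * derivative W) + derivative g * U' * W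
          - π ^ n * W ^ 2 * (C a * X + C b), ?_⟩
        push_cast
        apply mul_left_cancel₀ hπ.ne_zero
        rw [derivative_mul] at e2
        linear_combination -e2
      simpa [hp.dvd_mul, hn2, hU, hd, hW, -Nat.cast_mul, -Nat.cast_add] using this
    exact hπ.not_isUnit (hsq π (mul_dvd_mul_left π hg))
  obtain ⟨v, hv, rfl⟩ := isUnit_iff.mp hunit
  have hv0 := hv.ne_zero
  obtain ⟨ha, hb⟩ := lemR_unit f U' hf hf3 (v * a) (v * b) (by
    have : (C v : K[X]) ≠ 0 := by simpa using hv0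
    apply mul_left_cancel₀ this
    simp only [derivative_C, mul_zero, sub_zero, C_mul] at h' ⊢
    linear_combination h')
  constructor
  · simpa [hv0] using ha
  · simpa [hv0] using hb

end lemR

section base
variable {k : Type*} [Field k]

variable (k) in
/-- `t` in `k[t][q]` -/
def tS : k[X][X] := C X
lemma tS_def : tS k = C X := rfl

variable (k) in
/-- the cubic -/
def fS : k[X][X] := X * (X - 1) * (X - (tS k))
/-- the derivation on `k[t][q]` -/
def DS : Derivation k k[X][X] k[X][X] :=
  (((tS k) * ((tS k) - 1)) : k[X][X]) • mc (dX : Derivation k k[X] k[X]) + ((X * (X - 1)) : k[X][X]) • dX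

lemma DS_apply (a : k[X][X]) : DS a = (tS k) * ((tS k) - 1) * mc (dX : Derivation k k[X] k[X]) a
    + X * (X - 1) * derivative a := rfl

lemma DS_C (a : k[X]) : DS (C a : k[X][X]) = (tS k) * ((tS k) - 1) * C (derivative a) := by
  simp [DS_apply]

lemma DS_t : DS (tS k) = (tS k) * ((tS k) - 1) := by
  rw [tS, DS_C, derivative_X]; simp [tS]

lemma DS_X : DS (X : k[X][X]) = X * (X - 1) := by
  simp [DS_apply]

lemma DS_f : DS (fS k) = (fS k) * (3 * X + (tS k) - 2) := by
  simp only [fS, Derivation.leibniz, map_sub, DS_t, DS_X, Derivation.map_one_eq_zero, smul_eq_mul]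
  ring

lemma fS_ne : (fS k) ≠ 0 := by
  have h1 : (X - 1 : k[X][X]) ≠ 0 := X_sub_C_ne_zero 1
  exact mul_ne_zero (mul_ne_zero X_ne_zero h1) (X_sub_C_ne_zero _)

lemma lemR_base [CharZero k] (U V : k[X][X]) (hV : V ≠ 0) (a b : k[X])
    (h : 2 * (fS k) * (derivative U * V - U * derivative V) + derivative (fS k) * U * V
      = V ^ 2 * (C a * X + C b)) : a = 0 ∧ b = 0 := by
  let K := FractionRing k[X]
  have : CharZero K := charZero_of_injective_algebraMap (IsFractionRing.injective k[X] K)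
  have hi : Function.Injective (algebraMap k[X] K) := IsFractionRing.injective k[X] K
  set τ : K := algebraMap k[X] K X
  have hτ0 : τ ≠ 0 := by
    intro hh; exact X_ne_zero (hi (hh.trans (map_zero _).symm))
  have hτ1 : τ ≠ 1 := by
    intro hh
    exact (X_sub_C_ne_zero (1 : k)) (sub_eq_zero.mpr (hi (hh.trans (map_one _).symm)))
  have hfm : (fS k).map (algebraMap k[X] K) = (X - C 0) * (X - C 1) * (X - C τ) := by
    simp [fS, tS, τ]
  have hcop : ∀ x y : K, x ≠ y → IsCoprime (X - C x) (X - C y) := fun x y hxy =>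
    isCoprime_X_sub_C_of_isUnit_sub (IsUnit.mk0 _ (sub_ne_zero.mpr hxy))
  have hsep : ((X - C 0) * (X - C 1) * (X - C τ) : K[X]).Separable := by
    refine Separable.mul (Separable.mul separable_X_sub_C separable_X_sub_C ?_)
      separable_X_sub_C ?_
    · exact hcop _ _ zero_ne_one
    · exact IsCoprime.mul_left (hcop _ _ hτ0.symm) (hcop _ _ hτ1.symm)
  have hmon : ((X - C 0) * (X - C 1) * (X - C τ) : K[X]).Monic :=
    ((monic_X_sub_C _).mul (monic_X_sub_C _)).mul (monic_X_sub_C _)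
  have hdeg : ((X - C 0) * (X - C 1) * (X - C τ) : K[X]).natDegree = 3 := by
    rw [natDegree_mul, natDegree_mul]
    · simp only [natDegree_X_sub_C]
    all_goals first | exact X_sub_C_ne_zero _ | exact mul_ne_zero (X_sub_C_ne_zero _) (X_sub_C_ne_zero _)
  have h2 := congrArg (Polynomial.map (algebraMap k[X] K)) h
  simp only [Polynomial.map_add, Polynomial.map_mul, Polynomial.map_sub, Polynomial.map_pow,
    ← derivative_map, Polynomial.map_C, Polynomial.map_X, Polynomial.map_ofNat, hfm] at h2
  have hVm : V.map (algebraMap k[X] K) ≠ 0 := (Polynomial.map_ne_zero_iff hi).mpr hV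
  obtain ⟨ha, hb⟩ := lemR _ _ _ hmon hdeg hsep.squarefree hVm _ _ h2
  exact ⟨(map_eq_zero_iff _ hi).mp ha, (map_eq_zero_iff _ hi).mp hb⟩

lemma core [CharZero k] (n0 m0 n1 m1 : k[X][X]) (hn : n0 ≠ 0) (hm : m0 ≠ 0) (j m : ℕ)
    (T : (2 * (fS k) * derivative n0 - (j + m + 1) * derivative (fS k) * n0) * m0
      = n0 * (2 * (fS k) * derivative m0 - (j + 1) * derivative (fS k) * m0))
    (Nx : (2 * (fS k) * derivative n1 - ((j : k[X][X]) + (m : k[X][X])) * derivative (fS k) * n1 + DS n0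
          - ((j : k[X][X]) + (m : k[X][X]) + 1) * (2 * X - 1) * n0) * m0
        + (2 * (fS k) * derivative n0 - ((j : k[X][X]) + (m : k[X][X]) + 1) * derivative (fS k) * n0) * m1
      = n0 * (2 * (fS k) * derivative m1 - (j : k[X][X]) * derivative (fS k) * m1 + DS m0
          - ((j : k[X][X]) + 1) * (2 * X - 1) * m0)
        + n1 * (2 * (fS k) * derivative m0 - ((j : k[X][X]) + 1) * derivative (fS k) * m0)) :
    m = 0 ∧ ∃ c : k, n0 = c • m0 := by
  have hf := fS_ne (k := k)
  have hpow : ∃ g : k[X][X], derivative ((fS k) ^ m) = g * derivative (fS k) ∧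
      DS ((fS k) ^ m) = g * DS (fS k) ∧ g * (fS k) = m * (fS k) ^ m := by
    rcases m with _ | m
    · exact ⟨0, by simp, by simp, by simp⟩
    · refine ⟨(m + 1) * (fS k) ^ m, ?_, ?_, ?_⟩
      · rw [derivative_pow]; simp
      · rw [Derivation.leibniz_pow]; simp [mul_assoc]
      · push_cast; ring
  obtain ⟨g, hg1, hg2, hg3⟩ := hpow
  have hV1 : (fS k) ^ m * m0 ^ 2 ≠ 0 := mul_ne_zero (pow_ne_zero _ hf) (pow_ne_zero _ hm)
  have hd1 : derivative (n0 ^ 2) * ((fS k) ^ m * m0 ^ 2) = n0 ^ 2 * derivative ((fS k) ^ m * m0 ^ 2) := by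
    apply mul_left_cancel₀ hf
    simp only [derivative_mul, hg1, sq]
    linear_combination ((fS k) ^ m * n0 * m0) * T - n0 ^ 2 * m0 ^ 2 * derivative (fS k) * hg3
  have hc := deriv_const hV1 hd1
  have hc2 : ((fS k) ^ m * m0 ^ 2).leadingCoeff ≠ 0 := by simpa [-leadingCoeff_mul] using hV1
  have hc1 : (n0 ^ 2).leadingCoeff ≠ 0 := by simpa [-leadingCoeff_pow] using hn
  generalize ((fS k) ^ m * m0 ^ 2).leadingCoeff = c2 at hc hc2
  generalize (n0 ^ 2).leadingCoeff = c1 at hc hc1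
  have hDc := congrArg DS hc
  simp only [Derivation.leibniz, DS_C, hg2, sq, DS_f, smul_eq_mul] at hDc
  have hE : 2 * C c1 * C c2 * (DS n0 * m0 - n0 * DS m0) = n0 * m0 *
      ((tS k) * ((tS k) - 1) * (C c2 * C (derivative c1) - C c1 * C (derivative c2))
        + (m : k[X][X]) * (3 * X + (tS k) - 2) * C c1 * C c2) := by
    apply mul_left_cancel₀ hn
    linear_combination C c1 * m0 * hDc - (2 * C c1 * DS m0 + m0 * (tS k) * ((tS k) - 1) * C (derivative c1)
      + m0 * C c1 * (m : k[X][X]) * (3 * X + (tS k) - 2) ) * hc +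
      C c1 ^ 2 * m0 ^ 3 * (3 * X + (tS k) - 2) * hg3
  have hR := lemR_base (2 * C c1 * C c2 * (n1 * m0 - n0 * m1)) (n0 * m0) (mul_ne_zero hn hm)
    ((m : k[X]) * c1 * c2) (-((m : k[X]) * c1 * c2 * X) - X * (X - 1) * (c2 * derivative c1 - c1 * derivative c2)) (by
      simp only [derivative_mul, derivative_sub, derivative_C, derivative_ofNat, C_sub, C_mul, C_neg,
        C_1, map_natCast]
      rw [← tS_def]
      linear_combination 2 * C c1 * C c2 * (n0 * m0 * Nx - (n0 * m1 + n1 * m0) * T)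
        - n0 * m0 * hE)
  obtain ⟨hm0, he⟩ := hR
  have hm' : m = 0 := by simpa [hc1, hc2] using hm0
  subst hm'
  refine ⟨rfl, ?_⟩
  have hXX : (X * (X - 1) : k[X]) ≠ 0 := mul_ne_zero X_ne_zero (X_sub_C_ne_zero 1)
  have hc12 : (2 * C c1 * C c2 : k[X][X]) ≠ 0 := by simp [hc1, hc2]
  have hD0 : DS n0 * m0 = n0 * DS m0 := by
    apply mul_left_cancel₀ hc12
    have he' := congrArg (C : k[X] → k[X][X]) he
    simp only [C_sub, C_mul, C_neg, C_1, map_natCast, C_0] at he'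
    rw [← tS_def] at he'
    push_cast at he' hE
    linear_combination hE - n0 * m0 * he'
  have hd0 : derivative n0 * m0 = n0 * derivative m0 := by
    have h2f : (2 * (fS k) : k[X][X]) ≠ 0 := by simp [hf]
    apply mul_left_cancel₀ h2f
    push_cast at T
    linear_combination T
  have hcc := deriv_const hm hd0
  have hcc0 : n0.leadingCoeff ≠ 0 := by simpa using hn
  have hdd0 : m0.leadingCoeff ≠ 0 := by simpa using hm
  generalize n0.leadingCoeff = cc at hcc hcc0
  generalize m0.leadingCoeff = dd at hcc hdd0
  have hDcc := congrArg DS hcc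
  simp only [Derivation.leibniz, DS_C, smul_eq_mul] at hDcc
  have hw : derivative cc * dd = cc * derivative dd := by
    have hXX' : ((tS k) * ((tS k) - 1) : k[X][X]) ≠ 0 := by
      have : ((tS k) * ((tS k) - 1) : k[X][X]) = C (X * (X - 1)) := by simp [tS]
      rw [this]; simpa only [ne_eq, C_eq_zero] using hXX
    apply C_injective
    apply mul_left_cancel₀ (mul_ne_zero hXX' (pow_ne_zero 2 hm))
    simp only [C_mul]
    linear_combination -C dd * m0 * hDcc + C dd ^ 2 * hD0 +
      (C dd * DS m0 + (tS k) * ((tS k) - 1) * C (derivative dd) * m0) * hcc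
  have hk := deriv_const hdd0 hw
  have hl : dd.leadingCoeff ≠ 0 := by simpa using hdd0
  refine ⟨cc.leadingCoeff / dd.leadingCoeff, ?_⟩
  have hddC : (C dd : k[X][X]) ≠ 0 := by simpa using hdd0
  have hlC : (C (C dd.leadingCoeff) : k[X][X]) ≠ 0 := by simpa using hdd0
  apply mul_left_cancel₀ (mul_ne_zero hddC hlC)
  rw [Algebra.smul_def]
  have : (C (C dd.leadingCoeff) : k[X][X]) * algebraMap k k[X][X] (cc.leadingCoeff / dd.leadingCoeff)
      = C (C cc.leadingCoeff) := by
    rw [IsScalarTower.algebraMap_apply k k[X] k[X][X]]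
    simp only [algebraMap_eq, ← C_mul]
    rw [mul_div_cancel₀ _ hl]
  have hk' := congrArg (C : k[X] → k[X][X]) hk
  simp only [C_mul] at hk'
  linear_combination C (C dd.leadingCoeff) * hcc + m0 * hk' - C dd * m0 * this


lemma coeff_mul_next {S : Type*} [CommRing S] (p q : S[X]) (a b : ℕ) (hp : p.natDegree ≤ a + 1)
    (hq : q.natDegree ≤ b + 1) :
    (p * q).coeff (a + 1 + b) = p.coeff (a + 1) * q.coeff b + p.coeff a * q.coeff (b + 1) := by
  set p1 := p - C (p.coeff (a + 1)) * X ^ (a + 1) with hp1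
  have hd : p1.natDegree ≤ a := by
    rw [natDegree_le_iff_coeff_eq_zero]
    intro n hn
    rw [hp1, coeff_sub, coeff_C_mul_X_pow]
    split_ifs with h
    · rw [h, sub_self]
    · rw [coeff_eq_zero_of_natDegree_lt (by omega), sub_self]
  have e : p = C (p.coeff (a + 1)) * X ^ (a + 1) + p1 := by rw [hp1]; ring
  have ha : p1.coeff a = p.coeff a := by
    rw [hp1, coeff_sub, coeff_C_mul_X_pow, if_neg (by omega), sub_zero]
  have e2 : p * q = C (p.coeff (a + 1)) * (X ^ (a + 1) * q) + p1 * q := by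
    conv_lhs => rw [e]
    ring
  rw [e2, coeff_add, coeff_C_mul, add_comm (a + 1) b, coeff_X_pow_mul,
    show b + (a + 1) = a + (b + 1) by ring, coeff_mul_add_eq_of_natDegree_le hd hq, ha]

/-- the base derivation on `k[t][q][p]` -/
def dB : Derivation k k[X][X][X] k[X][X][X] :=
  mc DS + (C (2 * fS k) * X : k[X][X][X]) • mc (dX : Derivation k k[X][X] k[X][X])
    + (-(C (derivative (fS k)) * X ^ 2 + C (2 * X - 1) * X + C (C (C (1 / 4)))) : k[X][X][X]) • dX

lemma dB_apply (N : k[X][X][X]) : dB N = mc DS N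
    + C (2 * fS k) * X * mc (dX : Derivation k k[X][X] k[X][X]) N
    + (-(C (derivative (fS k)) * X ^ 2 + C (2 * X - 1) * X + C (C (C (1 / 4))))) * derivative N :=
  rfl

lemma dB_apply2 (N : k[X][X][X]) : dB N = mc DS N
    + C (2 * fS k) * (X * mc (dX : Derivation k k[X][X] k[X][X]) N)
    - C (derivative (fS k)) * (X * (X * derivative N)) - C (2 * X - 1) * (X * derivative N)
    - C (C (C (1 / 4))) * derivative N := by
  rw [dB_apply]; ring

lemma dB_coeff (N : k[X][X][X]) (i : ℕ) : (dB N).coeff (i + 1) = DS (N.coeff (i + 1))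
    + 2 * fS k * derivative (N.coeff i) - derivative (fS k) * ((i : k[X][X]) * N.coeff i)
    - (2 * X - 1) * (((i : k[X][X]) + 1) * N.coeff (i + 1))
    - C (C (1 / 4)) * (N.coeff (i + 2) * ((i : k[X][X]) + 2)) := by
  rw [dB_apply2]
  simp only [coeff_sub, coeff_add, coeff_C_mul, mc_coeff, coeff_X_mul, X_derivative_coeff,
    dX_apply, coeff_derivative]
  push_cast
  ring

lemma dB_natDegree (N : k[X][X][X]) : (dB N).natDegree ≤ N.natDegree + 1 := by
  rw [natDegree_le_iff_coeff_eq_zero]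
  intro n hn
  obtain ⟨n, rfl⟩ : ∃ i, n = i + 1 := ⟨n - 1, by omega⟩
  rw [dB_coeff]
  simp only [coeff_eq_zero_of_natDegree_lt (show N.natDegree < n by omega),
    coeff_eq_zero_of_natDegree_lt (show N.natDegree < n + 1 by omega),
    coeff_eq_zero_of_natDegree_lt (show N.natDegree < n + 2 by omega), map_zero]
  ring

lemma cst_aux [CharZero k] (N M : k[X][X][X]) (i j : ℕ) (hij : j ≤ i) (hN0 : N ≠ 0) (hM0 : M ≠ 0)
    (hN : N.natDegree = i + 1)
    (hM : M.natDegree = j + 1) (h : dB N * M = N * dB M) :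
    i = j ∧ ∃ c : k, N.leadingCoeff = c • M.leadingCoeff := by
  obtain ⟨m, rfl⟩ := Nat.exists_eq_add_of_le hij
  have hdN := dB_natDegree N
  have hdM := dB_natDegree M
  rw [hN] at hdN
  rw [hM] at hdM
  have hT := congrArg (fun p => p.coeff ((j + m + 1 + 1) + (j + 1))) h
  beta_reduce at hT
  rw [coeff_mul_add_eq_of_natDegree_le hdN hM.le,
    show (j + m + 1 + 1) + (j + 1) = (j + m + 1) + (j + 1 + 1) by ring,
    coeff_mul_add_eq_of_natDegree_le hN.le hdM, dB_coeff, dB_coeff] at hT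
  have hX := congrArg (fun p => p.coeff ((j + m + 1 + 1) + j)) h
  beta_reduce at hX
  rw [coeff_mul_next _ _ _ _ hdN hM.le,
    show (j + m + 1 + 1) + j = (j + m + 1) + (j + 1) by ring,
    coeff_mul_next _ _ _ _ hN.le hdM, dB_coeff, dB_coeff, dB_coeff, dB_coeff] at hX
  have z1 : N.coeff (j + m + 1 + 1) = 0 := coeff_eq_zero_of_natDegree_lt (by omega)
  have z2 : N.coeff (j + m + 1 + 2) = 0 := coeff_eq_zero_of_natDegree_lt (by omega)
  have z3 : M.coeff (j + 1 + 1) = 0 := coeff_eq_zero_of_natDegree_lt (by omega)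
  have z4 : M.coeff (j + 1 + 2) = 0 := coeff_eq_zero_of_natDegree_lt (by omega)
  have z5 : N.coeff (j + m + 2) = 0 := z1
  have z6 : M.coeff (j + 2) = 0 := z3
  rw [z1, z2, z3, z4] at hT
  rw [z1, z2, z3, z4] at hX
  simp only [map_zero] at hT hX
  have hn0 : N.coeff (j + m + 1) ≠ 0 := by rw [← hN]; simpa using hN0
  have hm0 : M.coeff (j + 1) ≠ 0 := by rw [← hM]; simpa using hM0
  obtain ⟨r1, r2⟩ := core (N.coeff (j + m + 1)) (M.coeff (j + 1)) (N.coeff (j + m)) (M.coeff j)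
    hn0 hm0 j m (by push_cast at hT ⊢; linear_combination hT)
    (by push_cast at hX ⊢; linear_combination hX)
  refine ⟨by omega, ?_⟩
  rw [← hN, ← hM] at r2
  exact r2

lemma wr_sub {A : Type*} [CommRing A] [Algebra k A] (δ : Derivation k A A) (N M : A) (c : k)
    (hh : δ N * M = N * δ M) : δ (N - c • M) * M = (N - c • M) * δ M := by
  simp only [map_sub, Derivation.map_smul, sub_mul, hh, smul_mul_assoc]
  simp only [mul_comm M]

lemma wr_mul {A : Type*} [CommRing A] [Algebra k A] (δ : Derivation k A A) (N M x : A)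
    (hh : δ N * M = N * δ M) : δ (N * x) * (M * x) = (N * x) * δ (M * x) := by
  simp only [Derivation.leibniz, smul_eq_mul]
  linear_combination x ^ 2 * hh

lemma wr_symm {A : Type*} [CommRing A] [Algebra k A] (δ : Derivation k A A) (N M : A)
    (hh : δ N * M = N * δ M) : δ M * N = M * δ N := by
  linear_combination -hh

lemma ratio_der {R : Type*} [CommRing R] [Algebra k R] [IsDomain R]
    (δ : Derivation k R[X] R[X])
    (H : ∀ (N M : R[X]) (i j : ℕ), j ≤ i → N ≠ 0 → M ≠ 0 → N.natDegree = i + 1 →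
      M.natDegree = j + 1 → δ N * M = N * δ M → i = j ∧
      ∃ c : k, N.leadingCoeff = c • M.leadingCoeff) :
    ∀ N M : R[X], M ≠ 0 → δ N * M = N * δ M → ∃ c : k, N = c • M := by
  refine ratio_of_lead (fun N M => δ N * M = N * δ M) (fun N M c hh => wr_sub δ N M c hh) ?_
  intro N M hN hM hh
  have h2 : δ (N * X) * (M * X) = (N * X) * δ (M * X) := wr_mul δ N M X hh
  have hNX : N * X ≠ 0 := mul_ne_zero hN X_ne_zero
  have hMX : M * X ≠ 0 := mul_ne_zero hM X_ne_zero
  rcases le_total M.natDegree N.natDegree with hle | hle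
  · obtain ⟨a, c, hc⟩ := H (N * X) (M * X) _ _ hle hNX hMX (natDegree_mul_X hN)
      (natDegree_mul_X hM) h2
    simp only [leadingCoeff_mul_X] at hc
    exact ⟨a, c, hc⟩
  · obtain ⟨a, c, hc⟩ := H (M * X) (N * X) _ _ hle hMX hNX (natDegree_mul_X hM)
      (natDegree_mul_X hN) (wr_symm δ _ _ h2)
    simp only [leadingCoeff_mul_X] at hc
    refine ⟨a.symm, c⁻¹, ?_⟩
    have hc0 : c ≠ 0 := by
      rintro rfl
      rw [zero_smul] at hc
      exact hM (leadingCoeff_eq_zero.mp hc)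
    rw [hc, smul_smul, inv_mul_cancel₀ hc0, one_smul]

lemma base_cst [CharZero k] (N M : k[X][X][X]) (hM : M ≠ 0) (h : dB N * M = N * dB M) :
    ∃ c : k, N = c • M :=
  ratio_der dB cst_aux N M hM h

lemma base_ex [CharZero k] (a b : k[X][X][X]) (ha : a ≠ 0) (hb : b ≠ 0) (n : ℤ)
    (h : dB a * b - a * dB b = (n : k[X][X][X]) * (X ^ 2 * (a * b))) : n = 0 := by
  have h3 := congrArg (fun p => p.coeff (a.natDegree + b.natDegree + 2)) h
  have e : ((n : k[X][X][X]) * (X ^ 2 * (a * b))) = C (n : k[X][X]) * (X ^ 2 * (a * b)) := by simp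
  beta_reduce at h3
  rw [e, coeff_sub, coeff_C_mul, coeff_X_pow_mul, coeff_mul_add_eq_of_natDegree_le le_rfl le_rfl,
      coeff_eq_zero_of_natDegree_lt, coeff_eq_zero_of_natDegree_lt] at h3
  · simp only [coeff_natDegree, sub_zero] at h3
    have := h3.symm
    simpa [ha, hb] using this
  · refine lt_of_le_of_lt natDegree_mul_le ?_
    have := dB_natDegree b
    omega
  · refine lt_of_le_of_lt natDegree_mul_le ?_
    have := dB_natDegree a
    omega

lemma exGood_three (k : Type u) [Field k] [CharZero k]
    (hd : ∀ F : k[X][X][X], F ≠ 0 → ∃ P : Ideal k[X][X][X], P.IsPrime ∧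
      (∀ x ∈ P, dB x ∈ P) ∧ P ≠ ⊥ ∧ F ∉ P) : ExGood k 3 := by
  refine ⟨k[X][X][X], inferInstance, inferInstance, inferInstance, dB, ?_, ?_,
    base_cst, ⟨X ^ 2, base_ex⟩, hd⟩
  · have h1 : Algebra.FiniteType k k[X] := inferInstance
    have h2 : Algebra.FiniteType k k[X][X] := h1.trans inferInstance
    exact h2.trans inferInstance
  · rw [Polynomial.ringKrullDim_of_isNoetherianRing, Polynomial.ringKrullDim_of_isNoetherianRing,
      Polynomial.ringKrullDim_of_isNoetherianRing, ringKrullDim_eq_zero_of_field]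
    rfl

end base

open TensorProduct in
lemma exists_der_ext (R S T : Type*) [CommRing R] [CommRing S] [CommRing T]
    [Algebra R S] [Algebra R T] [Algebra S T] [IsScalarTower R S T] [Algebra.FormallyEtale S T]
    (d : Derivation R S T) : ∃ D : Derivation R T T, ∀ s, D (algebraMap S T s) = d s := by
  let φ : T ⊗[S] (Ω[S⁄R]) →ₗ[T] T := LinearMap.liftBaseChange T d.liftKaehlerDifferential
  let ψ : Ω[T⁄R] →ₗ[T] T := φ ∘ₗ
    (KaehlerDifferential.tensorKaehlerEquivOfFormallyEtale R S T).symm.toLinearMap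
  refine ⟨ψ.compDer (KaehlerDifferential.D R T), ?_⟩
  intro s
  change φ ((KaehlerDifferential.tensorKaehlerEquivOfFormallyEtale R S T).symm
    (KaehlerDifferential.D R T (algebraMap S T s))) = d s
  rw [KaehlerDifferential.tensorKaehlerEquivOfFormallyEtale_symm_D_algebraMap]
  simp [φ]

lemma exists_L (k : Type u) [Field k] [CharZero k] :
    ∃ (L : Type u) (_ : Field L) (_ : Algebra k L) (_ : IsAlgClosed L) (D : Derivation k L L)
      (τ : L) (Γ : Type u) (_ : LinearOrderedCommGroupWithZero Γ) (v : Valuation L Γ),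
      D τ = τ * (τ - 1) ∧ τ ≠ 0 ∧ v τ < 1 ∧ (∀ c : k, v (algebraMap k L c) ≤ 1) ∧
      (∀ x : L, ∃ P : k[X][X], P ≠ 0 ∧ eval₂ (eval₂RingHom (algebraMap k L) τ) x P = 0) := by
  let K := FractionRing k[X]
  let L := AlgebraicClosure K
  have : CharZero K := charZero_of_injective_algebraMap (IsFractionRing.injective k[X] K)
  have i1 : Algebra.FormallyEtale k[X] K :=
    Algebra.FormallyEtale.of_isLocalization (nonZeroDivisors k[X])
  have i2 : Algebra.FormallyEtale K L := Algebra.FormallyEtale.of_isSeparable K L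
  have i3 : Algebra.FormallyEtale k[X] L := Algebra.FormallyEtale.comp k[X] K L
  have hinj : Function.Injective (algebraMap k[X] L) := by
    rw [IsScalarTower.algebraMap_eq k[X] K L]
    exact (algebraMap K L).injective.comp (IsFractionRing.injective k[X] K)
  let τ : L := algebraMap k[X] L X
  obtain ⟨D, hD⟩ := exists_der_ext k k[X] L (mkDerivation k (τ * (τ - 1)))
  have hev : (eval₂RingHom (algebraMap k L) τ) = algebraMap k[X] L := by
    apply Polynomial.ringHom_ext
    · intro a
      simp [IsScalarTower.algebraMap_apply k k[X] L]
    · simp [τ]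
  let A : Subring L := (algebraMap k[X] L).range
  let e : k[X] →+* A := (algebraMap k[X] L).rangeRestrict
  have he : Function.Bijective e :=
    ⟨fun a b hab => hinj (congrArg Subtype.val hab), (algebraMap k[X] L).rangeRestrict_surjective⟩
  have hI : Ideal.span {e X} ≠ ⊤ := by
    intro htop
    rw [Ideal.span_singleton_eq_top] at htop
    have := (isUnit_map_iff (RingEquiv.ofBijective e he) X).mp htop
    exact not_isUnit_X this
  obtain ⟨B, hAB, hB⟩ := Ideal.image_subset_nonunits_valuationSubring _ hI
  refine ⟨L, inferInstance, inferInstance, inferInstance, D, τ, B.ValueGroup, inferInstance,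
    B.valuation, ?_, ?_, ?_, ?_, ?_⟩
  · simp only [τ]
    rw [hD, mkDerivation_X]
  · intro h
    exact X_ne_zero (hinj (h.trans (map_zero _).symm))
  · rw [← ValuationSubring.mem_nonunits_iff]
    exact hB ⟨e X, Ideal.subset_span rfl, rfl⟩
  · intro c
    rw [B.valuation_le_one_iff]
    refine hAB ⟨C c, ?_⟩
    rw [IsScalarTower.algebraMap_apply k k[X] L]; rfl
  · intro x
    rw [hev]
    have h1 : IsAlgebraic K x := Algebra.IsAlgebraic.isAlgebraic x
    have h2 : IsAlgebraic k[X] x := (IsFractionRing.isAlgebraic_iff k[X] K L).mpr h1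
    obtain ⟨P, hP, hPx⟩ := h2
    exact ⟨P, hP, hPx⟩

section pts
variable {k L : Type*} [Field k] [Field L] [Algebra k L]

/-- algebraic points of the differential system -/
structure Pt (D : Derivation k L L) (τ q y z : L) : Prop where
  ne : y ≠ 0
  eq : y ^ 2 = q * (q - 1) * (q - τ)
  dq : D q = 2 * y * z + q * (q - 1)
  dz : D z = (τ - q) * z / 2 - y / 4

/-- evaluation -/
def evp (k : Type*) {L : Type*} [Field k] [Field L] [Algebra k L] (τ q p : L) :
    k[X][X][X] →+* L :=
  eval₂RingHom (eval₂RingHom (eval₂RingHom (algebraMap k L) τ) q) p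

lemma poly_closed {R : Type*} [CommRing R] (Q : R[X] → Prop) (hC : ∀ a, Q (C a)) (hX : Q X)
    (hadd : ∀ a b, Q a → Q b → Q (a + b)) (hmul : ∀ a b, Q a → Q b → Q (a * b)) : ∀ p, Q p := by
  intro p
  induction p using Polynomial.induction_on with
  | C a => exact hC a
  | add p q hp hq => exact hadd _ _ hp hq
  | monomial n a h =>
    rw [pow_succ, ← mul_assoc]
    exact hmul _ _ h hX

lemma two_mul_D (D : Derivation k L L) (x : L) : D (2 * x) = 2 * D x := by
  rw [two_mul, two_mul, map_add]

variable [CharZero L]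

lemma Pt.dp {D : Derivation k L L} {τ q y z : L} (hτ : D τ = τ * (τ - 1)) (h : Pt D τ q y z) :
    D (z / y) = -(((q - 1) * (q - τ) + q * (q - τ) + q * (q - 1)) * (z / y) ^ 2
      + (2 * q - 1) * (z / y) + 1 / 4) := by
  have hy := h.ne
  have h1 := congrArg D h.eq
  simp only [sq, Derivation.leibniz, map_sub, Derivation.map_one_eq_zero, smul_eq_mul, h.dq, hτ]
    at h1
  have hy2 : D y = ((q - 1) * (q - τ) + q * (q - τ) + q * (q - 1)) * z
      + y * (3 * q + τ - 2) / 2 := by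
    have h2y : 2 * y ≠ 0 := mul_ne_zero two_ne_zero hy
    apply mul_left_cancel₀ h2y
    linear_combination h1 - (3 * q + τ - 2) * h.eq
  have h3 : D z = D (z / y) * y + (z / y) * D y := by
    conv_lhs => rw [← div_mul_cancel₀ z hy]
    rw [Derivation.leibniz]
    simp only [smul_eq_mul]; ring
  have hz : z = (z / y) * y := (div_mul_cancel₀ z hy).symm
  generalize z / y = p at *
  rw [h.dz, hy2] at h3
  apply mul_right_cancel₀ hy
  rw [hz] at h3
  linear_combination -h3

lemma ev_neg {A B : Type*} [CommRing A] [CommRing B] (f : A[X] →+* B) (x : A[X]) :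
    f (-x) = -f x :=
  map_neg f x

lemma evp_D {D : Derivation k L L} {τ q y z : L} (hτ : D τ = τ * (τ - 1)) (h : Pt D τ q y z)
    (F : k[X][X][X]) : D (evp k τ q (z / y) F) = evp k τ q (z / y) (dB F) := by
  set ev := evp k τ q (z / y) with hev
  let Q : k[X][X][X] → Prop := fun F => D (ev F) = ev (dB F)
  have e3 : ev X = z / y := by simp [hev, evp]
  have e2 : ev (C X) = q := by simp [hev, evp]
  have e1 : ev (C (C X)) = τ := by simp [hev, evp]
  have e0 : ∀ a, ev (C (C (C a))) = algebraMap k L a := by intro a; simp [hev, evp]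
  have hadd : ∀ a b, Q a → Q b → Q (a + b) := by
    intro a b ha hb
    simp only [Q] at *
    rw [map_add, map_add, map_add, map_add, ha, hb]
  have hmul : ∀ a b, Q a → Q b → Q (a * b) := by
    intro a b ha hb
    simp only [Q] at *
    rw [map_mul, Derivation.leibniz, Derivation.leibniz, ha, hb]
    simp only [smul_eq_mul, map_add, map_mul]
  have f1 : ev (C (fS k)) = q * (q - 1) * (q - τ) := by
    simp only [fS, tS, C_mul, C_sub, C_1, map_mul, map_sub, map_one, e1, e2]
  have f2 : ev (C (derivative (fS k))) =
      (q - 1) * (q - τ) + q * (q - τ) + q * (q - 1) := by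
    simp only [fS, tS, derivative_mul, derivative_sub, derivative_X, derivative_one,
      derivative_C, C_mul, C_add, C_sub, C_1, C_0, map_mul, map_sub, map_one, map_zero,
      map_add, e1, e2]
    ring
  have h2 : ev (C (2 : k[X][X])) = 2 := by rw [C_ofNat, map_ofNat]
  refine poly_closed Q (fun a => ?_) ?_ hadd hmul F
  · refine poly_closed (fun a => Q (C a)) (fun a => ?_) ?_ ?_ ?_ a
    · refine poly_closed (fun a => Q (C (C a))) (fun a => ?_) ?_ ?_ ?_ a
      · simp only [Q, e0]
        rw [dB_apply, mc_C, mc_C, derivative_C, DS_C, dX_apply, derivative_C, derivative_C]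
        simp
      · simp only [Q, e1, hτ]
        rw [dB_apply, mc_C, mc_C, derivative_C, DS_C, dX_apply, derivative_C, derivative_X]
        simp only [tS, C_mul, C_sub, C_1, map_mul, map_sub, map_one, C_0, mul_zero, add_zero,
          mul_one, e1]
      · intro a b ha hb
        rw [C_add, C_add]; exact hadd _ _ ha hb
      · intro a b ha hb
        rw [C_mul, C_mul]; exact hmul _ _ ha hb
    · simp only [Q, e2, h.dq]
      rw [dB_apply, mc_C, mc_C, derivative_C, DS_X, dX_apply, derivative_X]
      simp only [C_mul, C_sub, C_1, map_mul, map_sub, map_one, map_add, mul_zero, add_zero,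
          mul_one, e2, e3, f1, h2, ← h.eq]
      have := h.ne
      field_simp
      ring
    · intro a b ha hb
      rw [C_add]; exact hadd _ _ ha hb
    · intro a b ha hb
      rw [C_mul]; exact hmul _ _ ha hb
  · simp only [Q, e3, h.dp hτ]
    rw [dB_apply, mc_X, mc_X, derivative_X, mul_zero, zero_add, zero_add, mul_one]
    refine Eq.trans ?_ (ev_neg ev _).symm
    congr 1
    simp only [C_mul, C_sub, C_1, map_mul, map_sub, map_one, map_add, map_neg, map_pow, mul_zero,
      zero_add, mul_one, e2, e3, f2, h2, e0, map_div₀, map_ofNat]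

lemma dense_of_pt {D : Derivation k L L} {τ q y z : L} (hτ : D τ = τ * (τ - 1))
    (h : Pt D τ q y z)
    (halg : ∃ P : k[X][X], P ≠ 0 ∧ eval₂ (eval₂RingHom (algebraMap k L) τ) q P = 0)
    (F : k[X][X][X]) (hF : evp k τ q (z / y) F ≠ 0) :
    ∃ P : Ideal k[X][X][X], P.IsPrime ∧ (∀ x ∈ P, dB x ∈ P) ∧ P ≠ ⊥ ∧ F ∉ P := by
  refine ⟨RingHom.ker (evp k τ q (z / y)), RingHom.ker_isPrime _, ?_, ?_, hF⟩
  · intro x hx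
    rw [RingHom.mem_ker] at hx ⊢
    rw [← evp_D hτ h, hx, map_zero]
  · intro hbot
    obtain ⟨P, hP, hP0⟩ := halg
    have : C P ∈ RingHom.ker (evp k τ q (z / y)) := by
      rw [RingHom.mem_ker]
      simpa [evp] using hP0
    rw [hbot] at this
    exact hP (by simpa using this)

lemma pt_zero [IsAlgClosed L] {D : Derivation k L L} {τ : L} (hτ : D τ = τ * (τ - 1))
    (h0 : τ ≠ 0) (h1 : τ ≠ 1) :
    ∃ q y z, Pt D τ q y z ∧ q ^ 2 = τ ∧ q * z / y = -1 / 4 := by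
  obtain ⟨s, hs⟩ := IsAlgClosed.exists_pow_nat_eq τ (n := 2) (by norm_num)
  obtain ⟨ι, hι⟩ := IsAlgClosed.exists_pow_nat_eq (-1 : L) (n := 2) (by norm_num)
  have hs0 : s ≠ 0 := by rintro rfl; simp at hs; exact h0 hs.symm
  have hs1 : s - 1 ≠ 0 := by
    intro h; rw [sub_eq_zero] at h; rw [h] at hs; simp at hs; exact h1 hs.symm
  have hι0 : ι ≠ 0 := by rintro rfl; simp at hι
  have hds : D s = s * (s ^ 2 - 1) / 2 := by
    have h := congrArg D hs
    rw [hτ, ← hs] at h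
    simp only [sq, Derivation.leibniz, smul_eq_mul] at h
    apply mul_left_cancel₀ (mul_ne_zero two_ne_zero hs0)
    linear_combination h
  have hdι : D ι = 0 := by
    have h := congrArg D hι
    simp only [sq, Derivation.leibniz, smul_eq_mul, map_neg, Derivation.map_one_eq_zero] at h
    apply mul_left_cancel₀ (mul_ne_zero two_ne_zero hι0)
    linear_combination h
  refine ⟨s, ι * s * (s - 1), -ι * (s - 1) / 4, ⟨?_, ?_, ?_, ?_⟩, hs, ?_⟩
  · exact mul_ne_zero (mul_ne_zero hι0 hs0) hs1
  · rw [← hs]; linear_combination s ^ 2 * (s - 1) ^ 2 * hι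
  · rw [hds]; linear_combination (s * (s - 1) ^ 2 / 2) * hι
  · have : 4 * D (-ι * (s - 1) / 4) = D (-ι * (s - 1)) := by
      have e : -ι * (s - 1) = 2 * (2 * (-ι * (s - 1) / 4)) := by ring
      conv_rhs => rw [e, two_mul_D, two_mul_D]
      ring
    simp only [Derivation.leibniz, smul_eq_mul, map_neg, map_sub, Derivation.map_one_eq_zero,
      hdι, hds] at this
    rw [← hs]
    linear_combination this / 4
  · field_simp

lemma pt_half {D : Derivation k L L} {τ q0 y0 z0 a b c : L} (hτ : D τ = τ * (τ - 1))
    (h : Pt D τ q0 y0 z0) (ha : a ^ 2 = q0) (hb : b ^ 2 = q0 - 1) (hc : c ^ 2 = q0 - τ)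
    (habc : a * b * c = y0) (hne : (a + b) * (b + c) * (c + a) ≠ 0) :
    Pt D τ ((a + b) * (a + c)) ((a + b) * (b + c) * (c + a)) (z0 / 2 - (a + b + c) / 4) := by
  have hy := h.ne
  have ha0 : a ≠ 0 := by rintro rfl; simp at habc; exact hy habc.symm
  have hb0 : b ≠ 0 := by rintro rfl; simp at habc; exact hy habc.symm
  have hc0 : c ≠ 0 := by rintro rfl; simp at habc; exact hy habc.symm
  have hq := h.dq
  have hz := h.dz
  rw [← habc] at hq hz
  have hda : D a = b * c * z0 + a * b ^ 2 / 2 := by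
    have e := congrArg D ha
    simp only [sq, Derivation.leibniz, smul_eq_mul, hq] at e
    apply mul_left_cancel₀ (mul_ne_zero two_ne_zero ha0)
    linear_combination e - q0 * hb - b ^ 2 * ha
  have hdb : D b = a * c * z0 + a ^ 2 * b / 2 := by
    have e := congrArg D hb
    simp only [sq, Derivation.leibniz, smul_eq_mul, map_sub, Derivation.map_one_eq_zero, hq] at e
    apply mul_left_cancel₀ (mul_ne_zero two_ne_zero hb0)
    linear_combination e - q0 * hb - b ^ 2 * ha
  have hτ' : τ = a ^ 2 - c ^ 2 := by linear_combination hc - ha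
  have h1 : (1 : L) = a ^ 2 - b ^ 2 := by linear_combination hb - ha
  have hdc : D c = a * b * z0 + c * (a ^ 2 + b ^ 2 - c ^ 2) / 2 := by
    have e := congrArg D hc
    simp only [sq, Derivation.leibniz, smul_eq_mul, map_sub, hq, hτ] at e
    rw [hτ', ← ha] at e
    apply mul_left_cancel₀ (mul_ne_zero two_ne_zero hc0)
    linear_combination e - c ^ 2 * h1
  have e1 : (a + b) * (a + c) - 1 = (b + a) * (b + c) := by linear_combination -h1
  have e2 : (a + b) * (a + c) - τ = (c + a) * (c + b) := by linear_combination -hτ'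
  refine ⟨hne, ?_, ?_, ?_⟩
  · rw [e1, e2]; ring
  · rw [e1]
    simp only [Derivation.leibniz, smul_eq_mul, map_add, hda, hdb, hdc]
    ring
  · have : 4 * D (z0 / 2 - (a + b + c) / 4) = D (2 * z0 - (a + b + c)) := by
      have e : 2 * z0 - (a + b + c) = 2 * (2 * (z0 / 2 - (a + b + c) / 4)) := by ring
      rw [e, two_mul_D, two_mul_D]
      ring
    rw [map_sub D (2 * z0), map_add D (a + b), map_add D a, two_mul_D, hda, hdb, hdc, hz] at this
    have e3 : τ - (a + b) * (a + c) = - ((c + a) * (c + b)) := by linear_combination -e2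
    rw [e3]
    have e4 : τ - q0 = - c ^ 2 := by linear_combination hc
    rw [e4] at this
    linear_combination this / 4

end pts

section val
variable {k L Γ : Type*} [Field k] [Field L] [Algebra k L] [LinearOrderedCommGroupWithZero Γ]
  (v : Valuation L Γ)

lemma v_unit (hk : ∀ c : k, v (algebraMap k L c) ≤ 1) (c : k) (hc : c ≠ 0) :
    v (algebraMap k L c) = 1 := by
  refine le_antisymm (hk c) ?_
  have h := hk c⁻¹
  have h0 : v (algebraMap k L c) ≠ 0 := by simpa using hc
  rw [map_inv₀, map_inv₀] at h
  exact (inv_le_one₀ (zero_lt_iff.mpr h0)).mp h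

variable [CharZero k] [CharZero L]

lemma step_pt [IsAlgClosed L] (hk : ∀ c : k, v (algebraMap k L c) ≤ 1)
    {D : Derivation k L L} {τ q0 y0 z0 : L} (hτ : D τ = τ * (τ - 1)) (hv : v τ < 1)
    (h : Pt D τ q0 y0 z0) (N : ℕ) (hN : 2 ≤ N) (hq : v q0 ^ N = v τ) (c0 : k)
    (hw : v (q0 * z0 / y0 - algebraMap k L c0) < 1) :
    ∃ q y z, Pt D τ q y z ∧ v q ^ (2 * N) = v τ ∧
      v (q * z / y - algebraMap k L (c0 / 2 - 1 / 4)) < 1 := by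
  have hy := h.ne
  have hyy : y0 ^ 2 ≠ 0 := pow_ne_zero _ hy
  rw [h.eq] at hyy
  have hqτ : q0 - τ ≠ 0 := right_ne_zero_of_mul hyy
  have hq00 : q0 ≠ 0 := left_ne_zero_of_mul (left_ne_zero_of_mul hyy)
  have v2 : v (2 : L) = 1 := by
    have := v_unit v hk (2 : k) two_ne_zero
    rwa [map_ofNat (algebraMap k L)] at this
  have v4 : v (4 : L) = 1 := by
    have := v_unit v hk (4 : k) (by norm_num)
    rwa [map_ofNat (algebraMap k L)] at this
  have hvq : v q0 < 1 := by
    by_contra hcon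
    exact absurd hv (not_lt.mpr (hq ▸ one_le_pow₀ (not_lt.mp hcon)))
  have hvq0 : 0 < v q0 := zero_lt_iff.mpr ((Valuation.ne_zero_iff v).mpr hq00)
  have hτq : v τ < v q0 := by
    rw [← hq]
    calc v q0 ^ N ≤ v q0 ^ 2 := pow_le_pow_right_of_le_one' hvq.le hN
      _ = v q0 * v q0 := sq _
      _ < v q0 := mul_lt_of_lt_one_right hvq0 hvq
  obtain ⟨a, ha⟩ := IsAlgClosed.exists_pow_nat_eq q0 (n := 2) (by norm_num)
  obtain ⟨c', hc'⟩ := IsAlgClosed.exists_pow_nat_eq (q0 - τ) (n := 2) (by norm_num)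
  have ha0 : a ≠ 0 := by rintro rfl; simp at ha; exact hq00 ha.symm
  have hu : ∃ u : L, (a * u) ^ 2 = q0 - τ ∧ v (u - 1) < 1 := by
    have e : (c' / a - 1) * (c' / a + 1) = - (τ / q0) := by
      rw [← ha]; rw [← ha] at hc'
      field_simp
      linear_combination hc'
    have e' : v (c' / a - 1) * v (c' / a + 1) < 1 := by
      rw [← map_mul, e, Valuation.map_neg, map_div₀, div_lt_one₀ hvq0]
      exact hτq
    by_cases hh : v (c' / a - 1) < 1
    · exact ⟨c' / a, by rw [mul_div_cancel₀ _ ha0, hc'], hh⟩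
    · refine ⟨- (c' / a), ?_, ?_⟩
      · rw [← hc']; field_simp
      · rw [show - (c' / a) - 1 = - (c' / a + 1) by ring, Valuation.map_neg]
        by_contra hh2
        exact absurd e' (not_lt.mpr (one_le_mul (not_lt.mp hh) (not_lt.mp hh2)))
  obtain ⟨u, hcu, hu1⟩ := hu
  have hu0 : u ≠ 0 := by
    rintro rfl; simp at hcu; exact hqτ hcu.symm
  have vu1 : v (1 + u) = 1 := by
    rw [show 1 + u = 2 + (u - 1) by ring, Valuation.map_add_eq_of_lt_left _ (by rw [v2]; exact hu1), v2]
  have vu : v u = 1 := by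
    rw [show u = 1 + (u - 1) by ring, Valuation.map_one_add_of_lt _ hu1]
  obtain ⟨b, hbdef⟩ : ∃ b : L, b = y0 / (a * (a * u)) := ⟨_, rfl⟩
  have habc : a * b * (a * u) = y0 := by rw [hbdef]; field_simp
  have hb : b ^ 2 = q0 - 1 := by
    have h1 : (q0 * (q0 - τ)) * b ^ 2 = (q0 * (q0 - τ)) * (q0 - 1) := by
      have := h.eq
      rw [← habc, mul_pow, mul_pow, ha, hcu] at this
      linear_combination this
    exact mul_left_cancel₀ (mul_ne_zero hq00 hqτ) h1
  have vb : v b = 1 := by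
    have : v b ^ 2 = 1 := by
      rw [← map_pow, hb, Valuation.map_sub_swap, sub_eq_add_neg, Valuation.map_one_add_of_lt]
      rwa [Valuation.map_neg]
    simpa using this
  have va2 : v a ^ 2 = v q0 := by rw [← map_pow, ha]
  have va : v a < 1 := by
    by_contra hcon
    exact absurd hvq (not_lt.mpr (va2 ▸ one_le_pow₀ (not_lt.mp hcon)))
  have vc : v (a * u) < 1 := by rw [map_mul, vu, mul_one]; exact va
  have vab : v (a + b) = 1 := by
    rw [Valuation.map_add_eq_of_lt_right _ (by rw [vb]; exact va), vb]
  have vbc : v (b + a * u) = 1 := by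
    rw [Valuation.map_add_eq_of_lt_left _ (by rw [vb]; exact vc), vb]
  have vne : ∀ x : L, v x = 1 → x ≠ 0 := by
    rintro x hx rfl; simp at hx
  have hbc0 := vne _ vbc
  have hab0 := vne _ vab
  have hu10 := vne _ vu1
  have hca0 : a * u + a ≠ 0 := by
    rw [show a * u + a = a * (1 + u) by ring]; exact mul_ne_zero ha0 hu10
  have hb0 := vne _ vb
  refine ⟨_, _, _, pt_half hτ h ha hb hcu habc
    (mul_ne_zero (mul_ne_zero hab0 hbc0) hca0), ?_, ?_⟩
  · rw [show (a + b) * (a + a * u) = (a + b) * (a * (1 + u)) by ring, map_mul, map_mul, vab, vu1,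
      one_mul, mul_one, pow_mul, va2, hq]
  · obtain ⟨w0, hw0⟩ : ∃ w0, w0 = q0 * z0 / y0 := ⟨_, rfl⟩
    rw [← hw0] at hw
    have hz : z0 = b * u * w0 := by
      rw [hw0, ← habc, ← ha]; field_simp
    have vw0 : v w0 ≤ 1 := by
      rw [show w0 = (w0 - algebraMap k L c0) + algebraMap k L c0 by ring]
      exact Valuation.map_add_le _ hw.le (hk c0)
    have e : (a + b) * (a + a * u) * (z0 / 2 - (a + b + a * u) / 4)
        / ((a + b) * (b + a * u) * (a * u + a)) - algebraMap k L (c0 / 2 - 1 / 4)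
        = (w0 - algebraMap k L c0) / 2
          + (((b * (u - 1) - a * u) * w0) / 2 - a / 4) / (b + a * u) := by
      rw [hz, map_sub, map_div₀, map_div₀, map_ofNat, map_ofNat, map_one]
      have : a + a * u ≠ 0 := by rwa [add_comm]
      have e1 : (a + b) * (a + a * u) * (b * u * w0 / 2 - (a + b + a * u) / 4)
        / ((a + b) * (b + a * u) * (a * u + a)) = (b * u * w0 / 2 - (a + b + a * u) / 4)
          / (b + a * u) := by
        rw [add_comm (a * u) a]
        field_simp
      rw [e1]
      clear e1
      obtain ⟨s, hs⟩ : ∃ s, s = b + a * u := ⟨_, rfl⟩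
      rw [← hs] at hbc0 ⊢
      field_simp
      rw [hs]
      ring
    rw [e]
    refine Valuation.map_add_lt _ ?_ ?_
    · rw [map_div₀, v2, div_one]; exact hw
    · rw [map_div₀, vbc, div_one]
      refine Valuation.map_sub_lt _ ?_ ?_
      · rw [map_div₀, v2, div_one, map_mul]
        refine mul_lt_one_of_lt_of_le ?_ vw0
        refine Valuation.map_sub_lt _ ?_ vc
        rw [map_mul, vb, one_mul]; exact hu1
      · rw [map_div₀, v4, div_one]; exact va

lemma chain_pt [IsAlgClosed L] (hk : ∀ c : k, v (algebraMap k L c) ≤ 1)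
    {D : Derivation k L L} {τ : L} (hτ : D τ = τ * (τ - 1)) (h0 : τ ≠ 0) (hv : v τ < 1) (n : ℕ) :
    ∃ q y z, Pt D τ q y z ∧ v q ^ (2 ^ (n + 1)) = v τ ∧
      v (q * z / y - algebraMap k L (-1 / 2 + (1 / 2) ^ n / 4)) < 1 := by
  induction n with
  | zero =>
    have h1 : τ ≠ 1 := by rintro rfl; simp at hv
    obtain ⟨q, y, z, h, hq, hw⟩ := pt_zero hτ h0 h1
    refine ⟨q, y, z, h, ?_, ?_⟩
    · rw [← hq]; simp
    · rw [hw]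
      have : (-1 / 4 : L) = algebraMap k L (-1 / 2 + (1 / 2) ^ 0 / 4) := by
        rw [show (-1 / 2 + (1 / 2) ^ 0 / 4 : k) = -1 / 4 by norm_num]
        rw [map_div₀, map_neg, map_one, map_ofNat]
      rw [this, sub_self, map_zero]; exact zero_lt_one
  | succ n ih =>
    obtain ⟨q, y, z, h, hq, hw⟩ := ih
    obtain ⟨q1, y1, z1, h1, hq1, hw1⟩ := step_pt v hk hτ hv h (2 ^ (n + 1))
      (by calc 2 = 2 ^ 1 := rfl
        _ ≤ 2 ^ (n + 1) := Nat.pow_le_pow_right (by norm_num) (by omega)) hq _ hw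
    refine ⟨q1, y1, z1, h1, ?_, ?_⟩
    · rw [pow_succ' 2 (n + 1)]; exact hq1
    · convert hw1 using 4
      ring

end val

section nonv
variable {k L Γ : Type*} [Field k] [Field L] [Algebra k L] [LinearOrderedCommGroupWithZero Γ]
  (v : Valuation L Γ)

lemma v_int {R : Type*} [CommRing R] (f : R →+* L) (hf : ∀ r, v (f r) ≤ 1) (x : L) (hx : v x ≤ 1)
    (p : R[X]) : v (eval₂RingHom f x p) ≤ 1 := by
  refine poly_closed (fun p => v (eval₂RingHom f x p) ≤ 1) (fun a => ?_) ?_ ?_ ?_ p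
  · simpa using hf a
  · simpa using hx
  · intro a b ha hb
    rw [map_add]; exact Valuation.map_add_le _ ha hb
  · intro a b ha hb
    rw [map_mul, map_mul]; exact mul_le_one' ha hb

lemma dec_closed {A B : Type*} [CommRing A] [CommRing B] (σ : B →+* A) (x : A) :
    (∀ a b, (∃ g h, a = σ g + x * h) → (∃ g h, b = σ g + x * h) → ∃ g h, a + b = σ g + x * h) ∧
    (∀ a b, (∃ g h, a = σ g + x * h) → (∃ g h, b = σ g + x * h) → ∃ g h, a * b = σ g + x * h) := by
  constructor
  · rintro _ _ ⟨g, h, rfl⟩ ⟨g', h', rfl⟩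
    exact ⟨g + g', h + h', by rw [map_add]; ring⟩
  · rintro _ _ ⟨g, h, rfl⟩ ⟨g', h', rfl⟩
    exact ⟨g * g', σ g * h' + h * σ g' + x * h * h', by rw [map_mul]; ring⟩

lemma dec1 {R : Type*} [CommRing R] (p : R[X]) : ∃ (g : R) (h : R[X]), p = (C : R →+* R[X]) g + X * h :=
  ⟨p.coeff 0, p.divX, by rw [add_comm]; exact (X_mul_divX_add p).symm⟩

/-- lifting a decomposition to one more variable -/
lemma dec_lift {A B : Type*} [CommRing A] [CommRing B] (σ : B →+* A) (x : A)
    (H : ∀ a : A, ∃ g h, a = σ g + x * h) (p : A[X]) :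
    ∃ (g : B[X]) (h : A[X]), p = mapRingHom σ g + C x * h := by
  obtain ⟨hadd, hmul⟩ := dec_closed (mapRingHom σ) (C x)
  refine poly_closed (fun p => ∃ (g : B[X]) (h : A[X]), p = mapRingHom σ g + C x * h)
    (fun a => ?_) ⟨X, 0, by simp⟩ hadd hmul p
  obtain ⟨g, h, e⟩ := H a
  exact ⟨C g, C h, by simp [e]⟩

lemma dec_pow {A B : Type*} [CommRing A] [IsDomain A] [WfDvdMonoid A] [CommRing B] (σ : B →+* A)
    (x : A) (hx : ¬ IsUnit x) (H : ∀ a : A, ∃ g h, a = σ g + x * h) (a : A) (ha : a ≠ 0) :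
    ∃ (i : ℕ) (g : B) (h : A), g ≠ 0 ∧ a = x ^ i * (σ g + x * h) := by
  obtain ⟨c, hc, hd⟩ := (FiniteMultiplicity.of_not_isUnit hx ha).exists_eq_pow_mul_and_not_dvd
  obtain ⟨g, h, e⟩ := H c
  refine ⟨_, g, h, ?_, by rw [← e]; exact hc⟩
  rintro rfl
  apply hd
  rw [e, map_zero, zero_add]
  exact dvd_mul_right _ _

lemma v_poly (hk : ∀ c : k, v (algebraMap k L c) ≤ 1) (P : k[X]) (c : k) (hc : P.eval c ≠ 0) (w : L)
    (hw : v (w - algebraMap k L c) < 1) : v (eval₂RingHom (algebraMap k L) w P) = 1 := by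
  have hw1 : v w ≤ 1 := by
    rw [show w = (w - algebraMap k L c) + algebraMap k L c by ring]
    exact Valuation.map_add_le _ hw.le (hk c)
  obtain ⟨Q, hQ⟩ := dvd_iff_isRoot.mpr (show (P - C (P.eval c)).IsRoot c by simp)
  have e : P = C (P.eval c) + (X - C c) * Q := by rw [← hQ]; ring
  have hu := v_unit v hk _ hc
  have e2 : eval₂RingHom (algebraMap k L) w P = algebraMap k L (P.eval c)
      + (w - algebraMap k L c) * eval₂RingHom (algebraMap k L) w Q := by
    conv_lhs => rw [e]
    simp
  rw [e2, Valuation.map_add_eq_of_lt_left, hu]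
  rw [hu, map_mul]
  exact mul_lt_one_of_lt_of_le hw (v_int v _ hk _ hw1 Q)

lemma cn_inj [CharZero k] : Function.Injective (fun n : ℕ => (-1 / 2 + (1 / 2) ^ n / 4 : k)) := by
  intro m n h
  have h1 : (1 / 2 : k) ^ m = (1 / 2) ^ n := by
    have : (-1 / 2 + (1 / 2) ^ m / 4 : k) = -1 / 2 + (1 / 2) ^ n / 4 := h
    linear_combination 4 * this
  rw [one_div, inv_pow, inv_pow, inv_inj] at h1
  have h2 : ((2 ^ m : ℕ) : k) = ((2 ^ n : ℕ) : k) := by push_cast; exact h1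
  exact Nat.pow_right_injective le_rfl (Nat.cast_injective h2)

lemma exists_cn [CharZero k] (P : k[X]) (hP : P ≠ 0) (j : ℕ) :
    ∃ n, j ≤ n ∧ P.eval (-1 / 2 + (1 / 2) ^ n / 4) ≠ 0 := by
  by_contra hcon
  push Not at hcon
  have hf : Set.Finite {n : ℕ | P.eval (-1 / 2 + (1 / 2) ^ n / 4) = 0} := by
    have := (Polynomial.finite_setOf_isRoot hP).preimage (cn_inj (k := k)).injOn
    exact this
  exact Set.infinite_of_injective_forall_mem (f := fun i : ℕ => i + j) (add_left_injective j)
    (fun i => hcon (i + j) (by omega)) hf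

lemma evp_ne [CharZero k] (hk : ∀ c : k, v (algebraMap k L c) ≤ 1) {τ : L} (h0 : τ ≠ 0)
    (hv : v τ < 1) (F : k[X][X][X]) (hF : F ≠ 0) :
    ∃ n : ℕ, ∀ q p : L, v q ^ (2 ^ (n + 1)) = v τ →
      v (q * p - algebraMap k L (-1 / 2 + (1 / 2) ^ n / 4)) < 1 → evp k τ q p F ≠ 0 := by
  have hH : scaleRoots F (X : k[X][X]) ≠ 0 := scaleRoots_ne_zero hF _
  obtain ⟨i, G, H2, hG, e1⟩ := dec_pow (A := k[X][X][X]) (mapRingHom (mapRingHom C)) (C (C X))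
    (by simp [isUnit_C, not_isUnit_X]) (dec_lift _ _ (dec_lift _ _ dec1)) _ hH
  obtain ⟨j, P, G2, hP, e2⟩ := dec_pow (A := k[X][X]) (mapRingHom C) (C X)
    (by simp [isUnit_C, not_isUnit_X]) (dec_lift _ _ dec1) _ hG
  obtain ⟨n, hjn, hn⟩ := exists_cn P hP j
  refine ⟨n, fun q p hq hw hz => ?_⟩
  have vτ0 : v τ ≠ 0 := (Valuation.ne_zero_iff v).mpr h0
  have hq1 : v q < 1 := by
    by_contra hcon
    exact absurd hv (not_lt.mpr (hq ▸ one_le_pow₀ (not_lt.mp hcon)))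
  have vq0 : v q ≠ 0 := by
    intro h; rw [h, zero_pow (by positivity)] at hq; exact vτ0 hq.symm
  have hq0 : q ≠ 0 := (Valuation.ne_zero_iff v).mp vq0
  obtain ⟨w, hwd⟩ : ∃ w, w = q * p := ⟨_, rfl⟩
  rw [← hwd] at hw
  have hw1 : v w ≤ 1 := by
    rw [show w = (w - algebraMap k L (-1 / 2 + (1 / 2) ^ n / 4))
      + algebraMap k L (-1 / 2 + (1 / 2) ^ n / 4) by ring]
    exact Valuation.map_add_le _ hw.le (hk _)
  have hzero : evp k τ q w (scaleRoots F (X : k[X][X])) = 0 := by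
    have := scaleRoots_eval₂_mul (p := F) (eval₂RingHom (eval₂RingHom (algebraMap k L) τ) q) p X
    have h3 : eval₂ (eval₂RingHom (eval₂RingHom (algebraMap k L) τ) q) p F = 0 := hz
    rw [h3, mul_zero] at this
    rw [hwd]
    simpa [evp] using this
  have s1 : ∀ g : k[X][X], evp k τ q w (mapRingHom (mapRingHom C) g)
      = eval₂RingHom (eval₂RingHom (algebraMap k L) q) w g := by
    intro g
    simp only [evp, coe_eval₂RingHom, coe_mapRingHom, eval₂_map]
    congr 1
    ext <;> simp
  have s2 : ∀ g : k[X], eval₂RingHom (eval₂RingHom (algebraMap k L) q) w (mapRingHom C g)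
      = eval₂RingHom (algebraMap k L) w g := by
    intro g
    simp only [coe_eval₂RingHom, coe_mapRingHom, eval₂_map]
    congr 1
    ext; simp
  have t1 : evp k τ q w (C (C X)) = τ := by simp [evp]
  have t2 : eval₂RingHom (eval₂RingHom (algebraMap k L) q) w (C X) = q := by simp
  rw [e1, map_mul, map_pow, map_add, map_mul, s1, t1, e2, map_mul, map_pow, map_add, map_mul, s2,
    t2] at hzero
  have hz2 := (mul_eq_zero.mp hzero).resolve_left (pow_ne_zero _ h0)
  have i1 : v (evp k τ q w H2) ≤ 1 :=
    v_int v _ (fun r => v_int v _ (fun r => v_int v _ hk _ hv.le r) _ hq1.le r) _ hw1 H2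
  have i2 : v (eval₂RingHom (eval₂RingHom (algebraMap k L) q) w G2) ≤ 1 :=
    v_int v _ (fun r => v_int v _ hk _ hq1.le r) _ hw1 G2
  have i3 := v_poly v hk P _ hn w hw
  have i4 : v (eval₂RingHom (algebraMap k L) w P
      + q * eval₂RingHom (eval₂RingHom (algebraMap k L) q) w G2) = 1 := by
    rw [Valuation.map_add_eq_of_lt_left, i3]
    rw [i3, map_mul]
    exact mul_lt_one_of_lt_of_le hq1 i2
  have i5 := congrArg v (eq_neg_of_add_eq_zero_left hz2)
  rw [Valuation.map_neg, map_mul, map_mul, map_pow, i4, mul_one] at i5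
  have i6 : v q ^ j ≤ v τ := by
    rw [i5]
    exact mul_le_of_le_one_right' i1
  rw [← hq] at i6
  have : v q ^ (2 ^ (n + 1)) < v q ^ j := by
    apply pow_lt_pow_right_of_lt_one₀ (zero_lt_iff.mpr vq0) hq1
    calc j ≤ n := hjn
      _ < n + 1 := Nat.lt_succ_self _
      _ < 2 ^ (n + 1) := Nat.lt_two_pow_self
  exact absurd i6 (not_le.mpr this)

end nonv

lemma exGood_base (k : Type u) [Field k] [CharZero k] : ExGood k 3 := by
  refine exGood_three k fun F hF => ?_
  obtain ⟨L, _, _, _, D, τ, Γ, _, v, hτ, h0, hv, hk, halg⟩ := exists_L k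
  haveI : CharZero L := charZero_of_injective_algebraMap (algebraMap k L).injective
  obtain ⟨n, hn⟩ := evp_ne v hk h0 hv F hF
  obtain ⟨q, y, z, h, hq, hw⟩ := chain_pt v hk hτ h0 hv n
  exact dense_of_pt hτ h (halg q) F (hn q (z / y) hq (by rwa [← mul_div_assoc]))

lemma exGood_all (k : Type u) [Field k] [CharZero k] (n : ℕ) : ExGood k (n + 3) := by
  induction n with
  | zero => exact exGood_base k
  | succ n ih => exact exGood_succ k _ ih

end PoisCex
end PoisCexHelpers

/-- Let `k` be a field of characteristic zero and `d ≥ 4`.  Then there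
exists an affine Poisson `k`-algebra of Krull dimension `d` in which `(0)` is Poisson
rational but not Poisson locally closed. -/
theorem exists_poisson_counterexample_over
    (k : Type u) [Field k] [CharZero k] (d : ℕ) (hd : 4 ≤ d) :
    Nonempty (PoissonCounterexampleOver k d) := by
  obtain ⟨n, rfl⟩ := Nat.exists_eq_add_of_le hd
  rw [show 4 + n = n + 2 + 2 by omega]
  exact PoisCex.cex_of_exGood k (n + 2) (PoisCex.exGood_all k n)
end

section
/- Let k be a field of characteristic zero and let A be an affine k-algebra (a finitely generated integral domain k-algebra) equipped with a Poisson bracket {-,-}. Suppose that every element of Frac(A) that is algebraic over k lies in k (i.e., k^alg ∩ Frac(A) = k), and that (0) is a Poisson rational ideal of A. Then for any algebraically closed field extension F of k, the F-algebra B := A ⊗_k F is again an integral domain, and (0) is a Poisson rational ideal of B with respect to the natural extension of {-,-} to B. -/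
open scoped TensorProduct

attribute [local instance] Algebra.TensorProduct.rightAlgebra

section PoissonExtension

variable {k A K : Type*} [Field k] [CommRing A] [IsDomain A] [Algebra k A]
  [Field K] [Algebra k K] [Algebra A K] [IsScalarTower k A K] [IsFractionRing A K]

/-- A derivation on the fraction field which vanishes on `A` is zero. -/
lemma der_eq_zero {M : Type*} [AddCommGroup M] [Module k M] [Module K M]
    (D : Derivation k K M) (h : ∀ a : A, D (algebraMap A K a) = 0) : D = 0 := by
  ext x
  obtain ⟨a, b, hb, rfl⟩ := IsFractionRing.div_surjective (A := A) x
  rw [Derivation.leibniz_div]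
  simp [h]

/-- Existence of extensions of derivations to the fraction field. -/
lemma der_exists {M : Type*} [AddCommGroup M] [Module k M] [Module A M] [Module K M]
    [IsScalarTower k K M] [IsScalarTower k A M] [IsScalarTower A K M]
    (d : Derivation k A M) : ∃ D : Derivation k K M, ∀ a : A, D (algebraMap A K a) = d a := by
  have := Algebra.FormallyEtale.of_isLocalization (Rₘ := K) (nonZeroDivisors A)
  have hb := KaehlerDifferential.isBaseChange_of_formallyEtale k A K
  let l := hb.lift d.liftKaehlerDifferential
  refine ⟨l.compDer (KaehlerDifferential.D k K), fun a => ?_⟩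
  have h := hb.lift_eq d.liftKaehlerDifferential (KaehlerDifferential.D k A a)
  rw [KaehlerDifferential.map_D, Derivation.liftKaehlerDifferential_comp_D] at h
  exact h

/-- A Poisson bracket extends to the fraction field. -/
lemma poisson_ext (pb : PoissonBracket k A) : ∃ pbK : PoissonBracket k K,
    ∀ a b : A, pbK.br (algebraMap A K a) (algebraMap A K b) = algebraMap A K (pb.br a b) := by
  have h0 : ∀ a : A, ∃ D : Derivation k K K,
      ∀ b : A, D (algebraMap A K b) = algebraMap A K (pb.br a b) := by
    intro a
    let d : Derivation k A K := Derivation.mk' ((Algebra.linearMap A K).restrictScalars k ∘ₗ pb.br a)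
      (by
        intro x y
        have h1 := pb.leibniz x y a
        rw [pb.antisymm (x * y) a, pb.antisymm x a, pb.antisymm y a] at h1
        have h2 : pb.br a (x * y) = x * pb.br a y + y * pb.br a x := by
          linear_combination -h1
        simp [h2, Algebra.smul_def])
    exact der_exists d
  choose D hD using h0
  have hDext : ∀ (E E' : Derivation k K K),
      (∀ a : A, E (algebraMap A K a) = E' (algebraMap A K a)) → E = E' := by
    intro E E' h
    rw [← sub_eq_zero]
    apply der_eq_zero (A := A)
    intro a
    simp [h]
  let d : Derivation k A (Derivation k K K) := Derivation.mk'
    { toFun := D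
      map_add' := fun a b => hDext _ _ fun c => by simp [hD]
      map_smul' := fun r a => hDext _ _ fun c => by
        rw [hD, map_smul, LinearMap.smul_apply, Algebra.smul_def, map_mul,
          ← IsScalarTower.algebraMap_apply, ← Algebra.smul_def, ← hD]
        rfl }
    (fun a b => hDext _ _ fun c => by
      simp [hD, pb.leibniz, Algebra.smul_def])
  obtain ⟨G, hG⟩ := der_exists (K := K) d
  have hGA : ∀ a b : A, G (algebraMap A K a) (algebraMap A K b) = algebraMap A K (pb.br a b) := by
    intro a b
    rw [hG]
    exact hD a b
  -- evaluation in the second argument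
  let ev : K → Derivation k K K := fun y => Derivation.mk'
    { toFun := fun x => G x y
      map_add' := fun a b => by simp
      map_smul' := fun r a => by simp } (fun a b => by simp)
  have hev : ∀ x y, ev y x = G x y := fun x y => rfl
  have anti0 : ∀ (a : A) (y : K), G (algebraMap A K a) y + ev (algebraMap A K a) y = 0 := by
    intro a y
    have : G (algebraMap A K a) + ev (algebraMap A K a) = 0 := by
      apply der_eq_zero (A := A)
      intro b
      rw [Derivation.add_apply, hev, hGA, hGA, pb.antisymm a b]
      simp
    simpa using congrArg (fun E : Derivation k K K => E y) this
  have anti : ∀ x y : K, G x y + G y x = 0 := by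
    intro x y
    have : G x + ev x = 0 := by
      apply der_eq_zero (A := A)
      intro b
      rw [Derivation.add_apply, hev, add_comm]
      exact anti0 b x
    simpa [hev] using congrArg (fun E : Derivation k K K => E y) this
  have anti' : ∀ x y : K, G x y = - G y x := fun x y => eq_neg_of_add_eq_zero_left (anti x y)
  let J : K → K → K → K := fun x y z => G x (G y z) + G z (G x y) + G y (G z x)
  have Jcyc : ∀ x y z, J x y z = J y z x := fun x y z => by simp only [J]; ring
  have Jlast : ∀ x y, (∀ c : A, J x y (algebraMap A K c) = 0) → ∀ z, J x y z = 0 := by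
    intro x y h
    have hJ : ∀ z, J x y z = (⁅G x, G y⁆ - G (G x y)) z := by
      intro z
      simp only [J, Derivation.sub_apply, Derivation.commutator_apply]
      rw [anti' z (G x y), anti' z x, map_neg]
      ring
    have : ⁅G x, G y⁆ - G (G x y) = 0 := by
      apply der_eq_zero (A := A)
      intro c
      rw [← hJ, h]
    intro z
    rw [hJ, this]
    simp
  have J1 : ∀ (a b : A) z, J (algebraMap A K a) (algebraMap A K b) z = 0 := by
    intro a b
    apply Jlast
    intro c
    simp only [J, hGA, ← map_add, pb.jacobi, map_zero]
  have J2 : ∀ (a : A) z y, J z (algebraMap A K a) y = 0 := by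
    intro a z
    apply Jlast
    intro b
    rw [Jcyc]
    exact J1 a b z
  have J3 : ∀ y z x, J y z x = 0 := by
    intro y z
    apply Jlast
    intro a
    rw [Jcyc]
    exact J2 a z y
  refine ⟨⟨LinearMap.mk₂ k (fun x y => G x y) (by simp) (by simp) (by simp) (by simp),
    anti', J3, ?_⟩, hGA⟩
  intro a b c
  simp

end PoissonExtension

section DSimple

/-- A minimal prime of a `k`-algebra, `k` of characteristic zero, is stable under derivations. -/
lemma minimalPrime_stable {k R : Type*} [Field k] [CharZero k] [CommRing R] [Algebra k R]
    (D : Derivation k R R) (P : Ideal R) (hP : P ∈ minimalPrimes R) (x : R) (hx : x ∈ P) :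
    D x ∈ P := by
  have hPp : P.IsPrime := hP.1.1
  obtain ⟨s, hs, n, hn⟩ : ∃ s, s ∉ P ∧ ∃ n : ℕ, s * x ^ n = 0 := by
    have hnil : IsNilpotent (algebraMap R (Localization.AtPrime P) x) := by
      have h1 := IsLocalization.AtPrime.radical_map_of_mem_minimalPrimes
        (Localization.AtPrime P) P (I := ⊥) hP
      have h2 := Ideal.mem_map_of_mem (algebraMap R (Localization.AtPrime P)) hx
      rw [← h1, Ideal.map_bot] at h2
      exact h2
    obtain ⟨n, hn⟩ := hnil
    rw [← map_pow, IsLocalization.map_eq_zero_iff P.primeCompl] at hn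
    obtain ⟨s, hs⟩ := hn
    exact ⟨s, s.2, n, hs⟩
  by_contra hD
  induction n generalizing s with
  | zero => exact hs (by simp at hn; simp [hn])
  | succ n ih =>
    have h1 := congrArg D hn
    rw [Derivation.leibniz, Derivation.leibniz_pow, map_zero] at h1
    simp only [smul_eq_mul, nsmul_eq_mul, Nat.add_sub_cancel] at h1
    refine ih (s * s * D x * ((n + 1 : ℕ) : R)) ?_ ?_
    · intro hmem
      have hu : ((n + 1 : ℕ) : R) ∉ P := by
        intro hm
        have hun : IsUnit ((n + 1 : ℕ) : R) := by
          have h2 : IsUnit ((n + 1 : ℕ) : k) :=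
            IsUnit.mk0 _ (Nat.cast_ne_zero.mpr (Nat.succ_ne_zero n))
          simpa using h2.map (algebraMap k R)
        exact hPp.ne_top (Ideal.eq_top_of_isUnit_mem _ hm hun)
      rcases hPp.mem_or_mem hmem with h | h
      · rcases hPp.mem_or_mem h with h | h
        · rcases hPp.mem_or_mem h with h | h <;> exact hs h
        · exact hD h
      · exact hu h
    · linear_combination s * h1 - D s * hn

variable {k K F ι : Type*} [Field k] [Field K] [Algebra k K] [Field F] [Algebra k F]

/-- Base change of a derivation. -/
noncomputable def derT (F : Type*) [Field F] [Algebra k F] (D : Derivation k K K) :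
    Derivation k (K ⊗[k] F) (K ⊗[k] F) :=
  Derivation.mk' (LinearMap.rTensor F (D : K →ₗ[k] K)) (by
    intro a b
    induction a with
    | zero => simp
    | add a a' ha ha' => simp only [add_mul, map_add, ha, ha', add_smul, smul_add]; abel
    | tmul a α =>
      induction b with
      | zero => simp
      | add a a' ha ha' => simp only [mul_add, map_add, ha, ha', add_smul, smul_add]; abel
      | tmul b β =>
        simp [TensorProduct.add_tmul, mul_comm])

lemma derT_tmul (D : Derivation k K K) (x : K) (α : F) :
    derT F D (x ⊗ₜ α) = D x ⊗ₜ α := rfl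

lemma repr_derT {ι : Type*} (b : Module.Basis ι k F) (D : Derivation k K K) (w : K ⊗[k] F) (i : ι) :
    (Algebra.TensorProduct.basis K b).repr (derT F D w) i
      = D ((Algebra.TensorProduct.basis K b).repr w i) := by
  induction w with
  | zero => simp
  | add a a' ha ha' => simp [ha, ha']
  | tmul a α =>
    rw [derT_tmul]
    simp [Algebra.TensorProduct.basis_repr_tmul, mul_comm]

lemma const_of_derT (D : ι → Derivation k K K)
    (hD : ∀ f : K, (∀ i, D i f = 0) → ∃ c : k, f = algebraMap k K c)
    (w : K ⊗[k] F) (hw : ∀ i, derT F (D i) w = 0) :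
    ∃ c : F, w = 1 ⊗ₜ c := by
  let b := Module.Basis.ofVectorSpace k F
  let B := Algebra.TensorProduct.basis K b
  have h1 : ∀ j, ∃ c : k, B.repr w j = algebraMap k K c := by
    intro j
    apply hD
    intro i
    rw [← repr_derT, hw]
    simp
  have h2 : w ∈ (Algebra.TensorProduct.includeRight : F →ₐ[k] K ⊗[k] F).range := by
    rw [← B.linearCombination_repr w, Finsupp.linearCombination_apply]
    refine sum_mem fun j _ => ?_
    obtain ⟨c, hc⟩ := h1 j
    rw [hc]
    refine ⟨c • b j, ?_⟩
    simp [B, Algebra.TensorProduct.basis_apply]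
  obtain ⟨c, hc⟩ := h2
  exact ⟨c, hc.symm⟩

lemma dsimple (D : ι → Derivation k K K)
    (hD : ∀ f : K, (∀ i, D i f = 0) → ∃ c : k, f = algebraMap k K c)
    (I : Ideal (K ⊗[k] F)) (hI : ∀ i, ∀ w ∈ I, derT F (D i) w ∈ I) (h0 : I ≠ ⊥) :
    I = ⊤ := by
  classical
  let b := Module.Basis.ofVectorSpace k F
  let B := Algebra.TensorProduct.basis K b
  have hsmul : ∀ (a : K) (w : K ⊗[k] F), w ∈ I → a • w ∈ I := by
    intro a w hw
    rw [Algebra.smul_def]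
    exact I.mul_mem_left _ hw
  have hex : ∃ n : ℕ, ∃ w ∈ I, w ≠ 0 ∧ (B.repr w).support.card = n := by
    obtain ⟨w, hw, hw0⟩ := Submodule.exists_mem_ne_zero_of_ne_bot h0
    exact ⟨_, w, hw, hw0, rfl⟩
  obtain ⟨w, hw, hw0, hcard⟩ := Nat.find_spec hex
  have hmin := fun m => Nat.find_min hex (m := m)
  rw [← hcard] at hmin
  obtain ⟨j, hj⟩ : ∃ j, B.repr w j ≠ 0 := by
    by_contra! h
    apply hw0
    apply B.repr.injective
    ext j
    simpa using h j
  let w' := (B.repr w j)⁻¹ • w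
  have hw' : w' ∈ I := hsmul _ _ hw
  have hrepr : ∀ l, B.repr w' l = (B.repr w j)⁻¹ * B.repr w l := by
    intro l
    simp [w']
  have hD0 : ∀ i, derT F (D i) w' = 0 := by
    intro i
    by_contra hne
    refine hmin _ ?_ ⟨_, hI i _ hw', hne, rfl⟩
    apply Finset.card_lt_card
    rw [Finset.ssubset_iff_of_subset]
    · refine ⟨j, by simpa using hj, ?_⟩
      rw [Finsupp.notMem_support_iff, repr_derT, hrepr, inv_mul_cancel₀ hj]
      simp
    · intro l hl
      rw [Finsupp.mem_support_iff, repr_derT] at hl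
      rw [Finsupp.mem_support_iff]
      intro h
      apply hl
      rw [hrepr, h]
      simp
  obtain ⟨c, hc⟩ := const_of_derT D hD w' hD0
  have hc0 : c ≠ 0 := by
    rintro rfl
    have : B.repr w' j = 0 := by rw [hc]; simp
    rw [hrepr, inv_mul_cancel₀ hj] at this
    exact one_ne_zero this
  refine Ideal.eq_top_of_isUnit_mem _ hw' ?_
  rw [hc]
  exact (IsUnit.mk0 c hc0).map (Algebra.TensorProduct.includeRight : F →ₐ[k] K ⊗[k] F)

lemma isDomain_tensor [CharZero k] (D : ι → Derivation k K K)
    (hD : ∀ f : K, (∀ i, D i f = 0) → ∃ c : k, f = algebraMap k K c)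
    : IsDomain (K ⊗[k] F) := by
  have hnt : Nontrivial (K ⊗[k] F) := inferInstance
  obtain ⟨P, hP⟩ := Ideal.nonempty_minimalPrimes (R := K ⊗[k] F) (I := ⊥) top_ne_bot.symm
  have hPp : P.IsPrime := hP.1.1
  have : P = ⊥ := by
    by_contra h
    exact hPp.ne_top (dsimple D hD P (fun i w hw => minimalPrime_stable _ P hP w hw) h)
  rw [this] at hPp
  exact IsDomain.of_bot_isPrime _

end DSimple

section Final

lemma isFractionRing_quot_bot (R : Type*) [CommRing R] [IsDomain R] :
    IsFractionRing R (FractionRing (R ⧸ (⊥ : Ideal R))) := by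
  have hinj : Function.Injective (algebraMap R (R ⧸ (⊥ : Ideal R))) := by
    rw [injective_iff_map_eq_zero]
    intro a ha
    simpa using Ideal.Quotient.eq_zero_iff_mem.mp ha
  have hdom : IsDomain (R ⧸ (⊥ : Ideal R)) :=
    Ideal.Quotient.isDomain _
  have hinj2 : Function.Injective (algebraMap R (FractionRing (R ⧸ (⊥ : Ideal R)))) := by
    rw [IsScalarTower.algebraMap_eq R (R ⧸ (⊥ : Ideal R))]
    exact (IsFractionRing.injective (R ⧸ (⊥ : Ideal R))
      (FractionRing (R ⧸ (⊥ : Ideal R)))).comp hinj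
  have : FaithfulSMul R (FractionRing (R ⧸ (⊥ : Ideal R))) :=
    (faithfulSMul_iff_algebraMap_injective _ _).mpr hinj2
  refine IsFractionRing.of_field _ _ fun z => ?_
  obtain ⟨x, y, hy, rfl⟩ := IsFractionRing.div_surjective (A := R ⧸ (⊥ : Ideal R)) z
  obtain ⟨x, rfl⟩ := Ideal.Quotient.mk_surjective x
  obtain ⟨y, rfl⟩ := Ideal.Quotient.mk_surjective y
  exact ⟨x, y, rfl⟩

/-- The Poisson center argument, for arbitrary fraction fields. -/
lemma center_alg {k A K F L : Type*} [Field k] [CommRing A] [IsDomain A] [Algebra k A]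
    [Field K] [Algebra k K] [Algebra A K] [IsScalarTower k A K] [IsFractionRing A K]
    [Field F] [Algebra k F] [Field L] [Algebra F L] [Algebra (A ⊗[k] F) L]
    [IsScalarTower F (A ⊗[k] F) L] [IsFractionRing (A ⊗[k] F) L]
    (D : A → Derivation k K K)
    (hD : ∀ f : K, (∀ i, D i f = 0) → ∃ c : k, f = algebraMap k K c)
    (E : A → Derivation F L L)
    (hDE : ∀ a b : A, ∃ c : A, D a (algebraMap A K b) = algebraMap A K c ∧
      E a (algebraMap (A ⊗[k] F) L (b ⊗ₜ 1)) = algebraMap (A ⊗[k] F) L (c ⊗ₜ 1))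
    (f : L) (hf : ∀ a, E a f = 0) : ∃ c : F, f = algebraMap F L c := by
  let : Algebra k L := ((algebraMap F L).comp (algebraMap k F)).toAlgebra
  have : IsScalarTower k F L := IsScalarTower.of_algebraMap_eq fun _ => rfl
  have hFL : ∀ α : F, algebraMap (A ⊗[k] F) L (1 ⊗ₜ α) = algebraMap F L α := by
    intro α
    rw [IsScalarTower.algebraMap_apply F (A ⊗[k] F) L]
    rfl
  let j : A →ₐ[k] L :=
    { toRingHom := (algebraMap (A ⊗[k] F) L).comp
        (Algebra.TensorProduct.includeLeft : A →ₐ[k] A ⊗[k] F).toRingHom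
      commutes' := fun r => by
        have : (algebraMap k A r) ⊗ₜ[k] (1 : F) = 1 ⊗ₜ algebraMap k F r := by
          rw [Algebra.algebraMap_eq_smul_one, Algebra.algebraMap_eq_smul_one,
            TensorProduct.smul_tmul]
        change algebraMap (A ⊗[k] F) L ((algebraMap k A r) ⊗ₜ[k] (1 : F)) = _
        rw [this, hFL]
        rfl }
  have hj : ∀ a, j a = algebraMap (A ⊗[k] F) L (a ⊗ₜ 1) := fun a => rfl
  have hjinj : Function.Injective j := by
    have h1 : Function.Injective (Algebra.TensorProduct.includeLeft : A →ₐ[k] A ⊗[k] F) :=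
      Algebra.TensorProduct.includeLeft_injective (algebraMap k F).injective
    exact (IsFractionRing.injective (A ⊗[k] F) L).comp h1
  let ψ : K →ₐ[k] L := IsFractionRing.liftAlgHom (g := j) hjinj
  have hψ : ∀ a : A, ψ (algebraMap A K a) = j a := fun a => by
    simp [ψ]
  have hψD : ∀ (a : A) (x : K), ψ (D a x) = E a (ψ x) := by
    intro a x
    have hA : ∀ b : A, ψ (D a (algebraMap A K b)) = E a (ψ (algebraMap A K b)) := by
      intro b
      obtain ⟨c, h1, h2⟩ := hDE a b
      rw [h1, hψ, hψ, hj, hj, h2]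
    obtain ⟨p, q, hq, rfl⟩ := IsFractionRing.div_surjective (A := A) x
    rw [map_div₀ ψ, Derivation.leibniz_div, Derivation.leibniz_div]
    simp [hA]
  let φ : K ⊗[k] F →ₐ[k] L := Algebra.TensorProduct.lift ψ (IsScalarTower.toAlgHom k F L)
    (fun _ _ => Commute.all _ _)
  have hφ : ∀ x α, φ (x ⊗ₜ α) = ψ x * algebraMap F L α := fun x α => by simp [φ]
  have hφD : ∀ a w, φ (derT F (D a) w) = E a (φ w) := by
    intro a w
    induction w with
    | zero => simp
    | add x y hx hy => simp [hx, hy]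
    | tmul x α =>
      rw [derT_tmul, hφ, hφ, Derivation.leibniz, Derivation.map_algebraMap, hψD]
      simp [mul_comm]
  have hφinj : Function.Injective φ := by
    rw [injective_iff_map_eq_zero]
    by_contra! h
    obtain ⟨w, hw, hw0⟩ := h
    have : RingHom.ker φ.toRingHom = ⊤ := by
      apply dsimple D hD
      · intro i w hw
        have hw : φ w = 0 := hw
        change φ _ = 0
        rw [hφD, hw, map_zero]
      · intro hb
        have : w ∈ RingHom.ker φ.toRingHom := hw
        rw [hb] at this
        exact hw0 this
    exact RingHom.ker_ne_top _ this
  have hBφ : ∀ v : A ⊗[k] F, ∃ w, φ w = algebraMap (A ⊗[k] F) L v := by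
    intro v
    induction v with
    | zero => exact ⟨0, by simp⟩
    | add x y hx hy =>
      obtain ⟨w, hw⟩ := hx
      obtain ⟨w', hw'⟩ := hy
      exact ⟨w + w', by simp [hw, hw']⟩
    | tmul a α =>
      refine ⟨algebraMap A K a ⊗ₜ α, ?_⟩
      rw [hφ, hψ, hj, ← hFL, ← map_mul]
      simp
  let I : Ideal (K ⊗[k] F) :=
    { carrier := {w | ∃ w', φ w * f = φ w'}
      zero_mem' := ⟨0, by simp⟩
      add_mem' := by
        rintro x y ⟨w, hw⟩ ⟨w', hw'⟩
        exact ⟨w + w', by rw [map_add, add_mul, hw, hw', map_add]⟩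
      smul_mem' := by
        rintro c x ⟨w, hw⟩
        exact ⟨c * w, by rw [smul_eq_mul, map_mul, mul_assoc, hw, map_mul]⟩ }
  have hI : I = ⊤ := by
    apply dsimple D hD
    · rintro i w ⟨w', hw'⟩
      refine ⟨derT F (D i) w', ?_⟩
      rw [hφD, hφD, ← hw', Derivation.leibniz, hf]
      simp [mul_comm]
    · obtain ⟨u, v, hv, huv⟩ := IsFractionRing.div_surjective (A := A ⊗[k] F) f
      obtain ⟨w, hw⟩ := hBφ u
      obtain ⟨w', hw'⟩ := hBφ v
      have hv0 : algebraMap (A ⊗[k] F) L v ≠ 0 :=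
        IsFractionRing.to_map_ne_zero_of_mem_nonZeroDivisors hv
      have hmem : w' ∈ I := ⟨w, by rw [hw, hw', ← huv]; field_simp⟩
      intro hb
      rw [hb] at hmem
      have : w' = 0 := hmem
      rw [← hw', this] at hv0
      simp at hv0
  have h1 : (1 : K ⊗[k] F) ∈ I := by rw [hI]; trivial
  obtain ⟨w, hw⟩ := h1
  rw [map_one, one_mul] at hw
  obtain ⟨c, hc⟩ := const_of_derT D hD w (fun i => hφinj (by rw [hφD, ← hw, hf, map_zero]))
  refine ⟨c, ?_⟩
  rw [hw, hc, hφ, map_one, one_mul]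

/-- The derivation bracketing with `a`. -/
noncomputable def PoissonBracket.der {k A : Type*} [CommRing k] [CommRing A] [Algebra k A]
    (pb : PoissonBracket k A) (a : A) : Derivation k A A :=
  Derivation.mk' (pb.br a) (by
    intro x y
    have h1 := pb.leibniz x y a
    rw [pb.antisymm (x * y) a, pb.antisymm x a, pb.antisymm y a] at h1
    simp only [smul_eq_mul]
    linear_combination -h1)

lemma PoissonBracket.der_apply {k A : Type*} [CommRing k] [CommRing A] [Algebra k A]
    (pb : PoissonBracket k A) (a b : A) : pb.der a b = pb.br a b := rfl

end Final

/-- Let `k` be a field of characteristic zero and `A` an affine Poisson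
`k`-algebra such that every element of `Frac(A)` algebraic over `k` lies in `k`, and such
that `(0)` is Poisson rational.  Then for any algebraically closed field extension `F`
of `k`, the `F`-algebra `B := A ⊗[k] F` is again an integral domain and `(0)` is a
Poisson rational ideal of `B` with respect to the natural extension of the bracket
(captured by quantifying over all Poisson brackets on `B` satisfying
`{a ⊗ α, b ⊗ β} = {a, b} ⊗ αβ`). -/
theorem base_change_poisson_rational
    (k A : Type*) [Field k] [CharZero k] [CommRing A] [IsDomain A] [Algebra k A]
    (hfg : Algebra.FiniteType k A) (pb : PoissonBracket k A)
    (halg : ∀ f : FractionRing A, IsAlgebraic k f →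
      ∃ c : k, f = algebraMap k (FractionRing A) c)
    (hrat : pb.IsPoissonRational ⊥)
    (F : Type*) [Field F] [Algebra k F] [IsAlgClosed F] :
    IsDomain (A ⊗[k] F) ∧
      ∀ pbB : PoissonBracket F (A ⊗[k] F),
        (∀ (a b : A) (α β : F),
          pbB.br (a ⊗ₜ[k] α) (b ⊗ₜ[k] β) = pb.br a b ⊗ₜ[k] (α * β)) →
        pbB.IsPoissonRational ⊥ := by
  have hfrA := isFractionRing_quot_bot A
  have hdA : IsDomain (A ⧸ (⊥ : Ideal A)) := Ideal.Quotient.isDomain _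
  obtain ⟨pbK, hpbK⟩ := poisson_ext (K := FractionRing (A ⧸ (⊥ : Ideal A))) pb
  let D : A → Derivation k (FractionRing (A ⧸ (⊥ : Ideal A))) (FractionRing (A ⧸ (⊥ : Ideal A))) :=
    fun a => pbK.der (algebraMap A _ a)
  have hD : ∀ f, (∀ a, D a f = 0) → ∃ c : k, f = algebraMap k _ c := by
    intro f hf
    have hf0 : pbK.der f = 0 := by
      apply der_eq_zero (A := A)
      intro a
      rw [PoissonBracket.der_apply, pbK.antisymm]
      have := hf a
      rw [PoissonBracket.der_apply] at this
      rw [this, neg_zero]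
    have halgf : IsAlgebraic k f := by
      refine hrat pbK (fun a b => hpbK a b) f fun g => ?_
      rw [← PoissonBracket.der_apply, hf0]
      rfl
    let e : FractionRing A ≃ₐ[A] FractionRing (A ⧸ (⊥ : Ideal A)) :=
      FractionRing.algEquiv A _
    let e' : FractionRing A ≃ₐ[k] FractionRing (A ⧸ (⊥ : Ideal A)) := e.restrictScalars k
    obtain ⟨c, hc⟩ := halg (e'.symm f) (halgf.algHom e'.symm.toAlgHom)
    refine ⟨c, ?_⟩
    rw [← e'.apply_symm_apply f, hc, AlgEquiv.commutes]
  have hdomK : IsDomain (FractionRing (A ⧸ (⊥ : Ideal A)) ⊗[k] F) := isDomain_tensor D hD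
  have hdom : IsDomain (A ⊗[k] F) := by
    let m : A ⊗[k] F →ₐ[k] FractionRing (A ⧸ (⊥ : Ideal A)) ⊗[k] F :=
      Algebra.TensorProduct.map (IsScalarTower.toAlgHom k A _) (AlgHom.id k F)
    have hm : Function.Injective m := by
      have := Module.Flat.rTensor_preserves_injective_linearMap (M := F)
        (IsScalarTower.toAlgHom k A (FractionRing (A ⧸ (⊥ : Ideal A)))).toLinearMap
        (IsFractionRing.injective A _)
      exact this
    exact hm.isDomain m.toRingHom
  refine ⟨hdom, ?_⟩
  intro pbB hB pbL hL f hf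
  have hfrB := isFractionRing_quot_bot (A ⊗[k] F)
  have hdB : IsDomain ((A ⊗[k] F) ⧸ (⊥ : Ideal (A ⊗[k] F))) := Ideal.Quotient.isDomain _
  have key := center_alg (L := FractionRing ((A ⊗[k] F) ⧸ (⊥ : Ideal (A ⊗[k] F)))) D hD
    (fun a => pbL.der (algebraMap (A ⊗[k] F) _ (a ⊗ₜ 1))) ?_ f ?_
  · obtain ⟨c, rfl⟩ := key
    exact isAlgebraic_algebraMap c
  · intro a b
    refine ⟨pb.br a b, hpbK a b, ?_⟩
    have := hL (a ⊗ₜ 1) (b ⊗ₜ 1)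
    rw [hB, mul_one] at this
    exact this
  · intro a
    rw [PoissonBracket.der_apply, pbL.antisymm, hf, neg_zero]
end
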